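/- arXiv:2510.26123 — 2 statements merged into one kernel-verified Lean document; each statement's English description precedes it below -/
import Mathlib

section
/- Suppose (f, g) satisfies the LDP recursive equation, and set c₁ = (√3·Γ(2/3)/(2π))·((3 + f(0))/2)^{1/3} > 0. Then, as R → ∞: Σ_{x∈ℤ, |x| > R} f(x) = 2c₁·R^{−2/3} + o(R^{−2/3}) and Σ_{y < −R} g(y) = c₁·R^{−2/3} + o(R^{−2/3}). -/
open Asymptotics Filter

section

open MeasureTheory Set Topology Polynomial

theorem integrableOn_rpow_mul_one_sub_exp {β : ℝ} (h0 : 0 < β) (h1 : β < 1) {k : ℝ} (hk : 0 ≤ k) :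
    IntegrableOn (fun y : ℝ => y ^ (-1 - β) * (1 - Real.exp (-(k * y)))) (Ioi 0) := by
  rw [← Ioc_union_Ioi_eq_Ioi zero_le_one]
  have hm : Measurable (fun y : ℝ => y ^ (-1 - β) * (1 - Real.exp (-(k * y)))) := by fun_prop
  have hle : ∀ y : ℝ, 0 < y → ‖y ^ (-1 - β) * (1 - Real.exp (-(k * y)))‖ =
      y ^ (-1 - β) * (1 - Real.exp (-(k * y))) := fun y hy => by
    rw [Real.norm_of_nonneg]
    have : Real.exp (-(k * y)) ≤ 1 := Real.exp_le_one_iff.2 (by nlinarith)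
    exact mul_nonneg (Real.rpow_nonneg hy.le _) (by linarith)
  refine IntegrableOn.union ?_ ?_
  · have hintg : IntegrableOn (fun y : ℝ => k * y ^ (-β)) (Ioc 0 1) :=
      ((intervalIntegrable_iff_integrableOn_Ioc_of_le zero_le_one).1
        (intervalIntegral.intervalIntegrable_rpow' (by linarith))).const_mul k
    refine hintg.mono' hm.aestronglyMeasurable ?_
    refine (ae_restrict_iff' measurableSet_Ioc).2 (.of_forall fun y hy => ?_)
    rw [hle y hy.1]
    have h2 : y ^ (-β) = y ^ (-1 - β) * y := by
      rw [← Real.rpow_add_one hy.1.ne']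
      ring_nf
    have h3 := Real.add_one_le_exp (-(k * y))
    have h4 := Real.rpow_nonneg hy.1.le (-1 - β)
    rw [h2]
    nlinarith
  · refine (integrableOn_Ioi_rpow_of_lt (by linarith : -1 - β < -1) zero_lt_one).mono'
      hm.aestronglyMeasurable ?_
    refine (ae_restrict_iff' measurableSet_Ioi).2 (.of_forall fun y hy => ?_)
    have hy' : (0 : ℝ) < y := lt_trans zero_lt_one hy
    rw [hle y hy']
    exact mul_le_of_le_one_right (Real.rpow_nonneg hy'.le _)
      (by linarith [Real.exp_pos (-(k * y))])

theorem integral_rpow_mul_one_sub_exp {β : ℝ} (h0 : 0 < β) (h1 : β < 1) {k : ℝ} (hk : 0 ≤ k) :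
    ∫ y in Ioi (0 : ℝ), y ^ (-1 - β) * (1 - Real.exp (-(k * y))) =
      k ^ β * (Real.Gamma (1 - β) / β) := by
  rcases hk.eq_or_lt with rfl | hk
  · simp [Real.zero_rpow h0.ne']
  have hu : ∀ y ∈ Ioi (0 : ℝ), HasDerivAt (fun y => 1 - Real.exp (-(k * y)))
      (k * Real.exp (-(k * y))) y := fun y _ => by
    have := (((hasDerivAt_id y).const_mul k).neg.exp).const_sub 1
    exact this.congr_deriv (by simp [mul_comm])
  have hv : ∀ y ∈ Ioi (0 : ℝ), HasDerivAt (fun y : ℝ => -(y ^ (-β) / β)) (y ^ (-1 - β)) y :=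
    fun y hy => by
    have := ((Real.hasDerivAt_rpow_const (p := -β) (Or.inl (ne_of_gt hy))).div_const β).neg
    refine this.congr_deriv ?_
    rw [show -1 - β = -β - 1 by ring]
    field_simp
  have hint1 := integrableOn_rpow_mul_one_sub_exp h0 h1 hk.le
  have hGamma : IntegrableOn (fun y : ℝ => y ^ (-β) * Real.exp (-k * y ^ (1 : ℝ))) (Ioi 0) :=
    integrableOn_rpow_mul_exp_neg_mul_rpow (by linarith) one_pos hk
  have hGv := integral_rpow_mul_exp_neg_mul_rpow one_pos (by linarith : -1 < -β) hk
  simp only [Real.rpow_one] at hGamma hGv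
  have heq : ∀ y : ℝ, k * Real.exp (-(k * y)) * -(y ^ (-β) / β) =
      -(k / β) * (y ^ (-β) * Real.exp (-k * y)) := fun y => by
    simp only [neg_mul]; ring
  have key := integral_Ioi_mul_deriv_eq_deriv_mul (a' := 0) (b' := 0) hu hv
    (by
      refine hint1.congr_fun (fun y _ => ?_) measurableSet_Ioi
      simp only [Pi.mul_apply]; ring)
    (by
      refine IntegrableOn.congr_fun (Integrable.const_mul hGamma (-(k / β)))
        (fun y _ => ?_) measurableSet_Ioi
      simp only [Pi.mul_apply]; rw [heq])
    (by
      have hlim : Tendsto (fun y : ℝ => k / β * y ^ (1 - β)) (𝓝[>] 0) (𝓝 0) := by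
        have : ContinuousAt (fun y : ℝ => k / β * y ^ (1 - β)) 0 :=
          continuousAt_const.mul (Real.continuousAt_rpow_const _ _ (Or.inr (by linarith)))
        have h2 := this.tendsto
        rw [Real.zero_rpow (by linarith), mul_zero] at h2
        exact h2.mono_left nhdsWithin_le_nhds
      refine squeeze_zero_norm' ?_ hlim
      filter_upwards [self_mem_nhdsWithin] with y hy
      have hy : 0 < y := hy
      have h3 := Real.add_one_le_exp (-(k * y))
      have h4 : Real.exp (-(k * y)) ≤ 1 := Real.exp_le_one_iff.2 (by nlinarith)
      have h5 : y ^ (1 - β) = y ^ (-β) * y := by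
        rw [← Real.rpow_add_one hy.ne']; ring_nf
      have h6 := Real.rpow_pos_of_pos hy (-β)
      simp only [Pi.mul_apply]
      rw [mul_neg, norm_neg, Real.norm_of_nonneg (mul_nonneg (by linarith) (by positivity)), h5]
      calc (1 - Real.exp (-(k * y))) * (y ^ (-β) / β) ≤ (k * y) * (y ^ (-β) / β) := by
            gcongr; linarith
        _ = _ := by ring)
    (by
      have hlim : Tendsto (fun y : ℝ => (1 / β) * y ^ (-β)) atTop (𝓝 0) := by
        simpa using (tendsto_rpow_neg_atTop h0).const_mul (1 / β)
      refine squeeze_zero_norm' ?_ hlim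
      filter_upwards [eventually_gt_atTop 0] with y hy
      have h4 : Real.exp (-(k * y)) ≤ 1 := Real.exp_le_one_iff.2 (by nlinarith)
      have h6 := Real.rpow_pos_of_pos hy (-β)
      simp only [Pi.mul_apply]
      rw [mul_neg, norm_neg, Real.norm_of_nonneg (mul_nonneg (by linarith) (by positivity))]
      calc (1 - Real.exp (-(k * y))) * (y ^ (-β) / β) ≤ 1 * (y ^ (-β) / β) := by
            gcongr; linarith [Real.exp_pos (-(k * y))]
        _ = _ := by ring)
  calc _ = ∫ y in Ioi (0 : ℝ), (1 - Real.exp (-(k * y))) * y ^ (-1 - β) := by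
        simp only [mul_comm]
    _ = _ := by
        rw [key]
        simp only [heq]
        rw [integral_const_mul, hGv]
        have : k ^ β = k * k ^ (-(-β + 1) / 1) := by
          rw [← Real.rpow_one_add' hk.le (by simp; linarith)]
          ring_nf
        rw [this, show (-β + 1) / 1 = 1 - β by ring]
        ring

theorem integrable_one_sub_exp_mul_comp {Ω : Type*} [MeasurableSpace Ω] {P : Measure Ω}
    [IsProbabilityMeasure P] {Y : Ω → ℝ} (hY : Measurable Y) (hY0 : ∀ ω, 0 ≤ Y ω)
    {q : ℝ → ℝ} (hq : Continuous q) {s : ℝ} (hs : 0 ≤ s) :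
    Integrable (fun ω => (1 - Real.exp (-(s * Y ω))) * q (Real.exp (-(s * Y ω)))) P := by
  obtain ⟨M, hM⟩ := isCompact_Icc.exists_bound_of_continuousOn (hq.continuousOn (s := Icc 0 1))
  refine Integrable.of_bound (C := M) ?_ (.of_forall fun ω => ?_)
  · have := hq.measurable
    exact Measurable.aestronglyMeasurable (by fun_prop)
  · have h1 : Real.exp (-(s * Y ω)) ≤ 1 :=
      Real.exp_le_one_iff.2 (by nlinarith [mul_nonneg hs (hY0 ω)])
    have h2 := Real.exp_pos (-(s * Y ω))
    rw [norm_mul, Real.norm_of_nonneg (by linarith : 0 ≤ 1 - Real.exp (-(s * Y ω)))]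
    calc _ ≤ 1 * ‖q (Real.exp (-(s * Y ω)))‖ := by gcongr; linarith
      _ ≤ M := by rw [one_mul]; exact hM _ ⟨h2.le, h1⟩

theorem integrableOn_rpow_mul_one_sub_exp_mul_comp {β : ℝ} (h0 : 0 < β) (h1 : β < 1)
    {q : ℝ → ℝ} (hq : Continuous q) :
    IntegrableOn (fun y : ℝ => y ^ (-1 - β) * ((1 - Real.exp (-y)) * q (Real.exp (-y))))
      (Ioi 0) := by
  obtain ⟨M, hM⟩ := isCompact_Icc.exists_bound_of_continuousOn (hq.continuousOn (s := Icc 0 1))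
  have hintg := integrableOn_rpow_mul_one_sub_exp h0 h1 zero_le_one
  simp only [one_mul] at hintg
  have hqm := hq.measurable
  refine IntegrableOn.congr_fun (Integrable.mul_bdd (c := M) hintg
    (g := fun y => q (Real.exp (-y))) (Measurable.aestronglyMeasurable (by fun_prop))
    ((ae_restrict_iff' measurableSet_Ioi).2 (.of_forall fun y hy => hM _ ⟨(Real.exp_pos _).le, ?_⟩)))
    (fun y _ => ?_) measurableSet_Ioi
  · exact Real.exp_le_one_iff.2 (by simpa using (le_of_lt hy : (0 : ℝ) ≤ y))
  · ring

theorem tendsto_integral_one_sub_exp_mul_polynomial {Ω : Type*} [MeasurableSpace Ω]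
    {P : Measure Ω} [IsProbabilityMeasure P] {Y : Ω → ℝ} (hY : Measurable Y)
    (hY0 : ∀ ω, 0 ≤ Y ω) {β D : ℝ} (h0 : 0 < β) (h1 : β < 1)
    (hL : Tendsto (fun s : ℝ => (∫ ω, (1 - Real.exp (-(s * Y ω))) ∂P) / s ^ β) (𝓝[>] 0) (𝓝 D))
    (q : ℝ[X]) :
    Tendsto (fun s : ℝ => (∫ ω, (1 - Real.exp (-(s * Y ω))) *
        q.eval (Real.exp (-(s * Y ω))) ∂P) / s ^ β) (𝓝[>] 0)
      (𝓝 (D * (β / Real.Gamma (1 - β)) * ∫ y in Ioi (0 : ℝ),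
        y ^ (-1 - β) * ((1 - Real.exp (-y)) * q.eval (Real.exp (-y))))) := by
  have hΓ : 0 < Real.Gamma (1 - β) := Real.Gamma_pos_of_pos (by linarith)
  induction q using Polynomial.induction_on' with
  | add p q hp hq =>
    have hI : ∫ y in Ioi (0 : ℝ), y ^ (-1 - β) * ((1 - Real.exp (-y)) *
        (p + q).eval (Real.exp (-y))) =
        (∫ y in Ioi (0 : ℝ), y ^ (-1 - β) * ((1 - Real.exp (-y)) * p.eval (Real.exp (-y)))) +
        ∫ y in Ioi (0 : ℝ), y ^ (-1 - β) * ((1 - Real.exp (-y)) * q.eval (Real.exp (-y))) := by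
      rw [← integral_add (integrableOn_rpow_mul_one_sub_exp_mul_comp h0 h1 p.continuous)
        (integrableOn_rpow_mul_one_sub_exp_mul_comp h0 h1 q.continuous)]
      congr 1 with y
      rw [Polynomial.eval_add]; ring
    rw [hI, mul_add]
    refine (hp.add hq).congr' ?_
    filter_upwards [self_mem_nhdsWithin] with s hs
    rw [← add_div, ← integral_add
      (integrable_one_sub_exp_mul_comp hY hY0 p.continuous (le_of_lt hs))
      (integrable_one_sub_exp_mul_comp hY hY0 q.continuous (le_of_lt hs))]
    congr 2 with ω
    rw [Polynomial.eval_add]; ring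
  | monomial n a =>
    have hpow : ∀ x : ℝ, (1 - Real.exp (-x)) * (monomial n a).eval (Real.exp (-x)) =
        a * ((1 - Real.exp (-((n + 1 : ℝ) * x))) - (1 - Real.exp (-((n : ℝ) * x)))) := fun x => by
      rw [Polynomial.eval_monomial, ← Real.exp_nat_mul,
        show -((n + 1 : ℝ) * x) = n * -x + -x by ring, Real.exp_add, mul_neg]
      ring
    have hscale : ∀ k : ℝ, 0 ≤ k → Tendsto (fun s : ℝ =>
        (∫ ω, (1 - Real.exp (-(k * (s * Y ω)))) ∂P) / s ^ β) (𝓝[>] 0) (𝓝 (k ^ β * D)) := by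
      intro k hk
      rcases hk.eq_or_lt with rfl | hk
      · simp [Real.zero_rpow h0.ne']
      have hk' : Tendsto (fun s : ℝ => k * s) (𝓝[>] 0) (𝓝[>] 0) := by
        refine tendsto_nhdsWithin_iff.2 ⟨?_, ?_⟩
        · have : Continuous fun s : ℝ => k * s := by fun_prop
          simpa using (this.tendsto 0).mono_left nhdsWithin_le_nhds
        · filter_upwards [self_mem_nhdsWithin] with s hs
          exact mul_pos hk hs
      refine ((hL.comp hk').const_mul (k ^ β)).congr' ?_
      filter_upwards [self_mem_nhdsWithin] with s hs
      have hs : 0 < s := hs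
      have := Real.rpow_pos_of_pos hk β
      simp only [Function.comp, Real.mul_rpow hk.le hs.le, mul_assoc]
      field_simp
    have hbd : ∀ k : ℝ, 0 ≤ k → ∀ s : ℝ, 0 < s →
        Integrable (fun ω => 1 - Real.exp (-(k * (s * Y ω)))) P := fun k hk s hs => by
      have := integrable_one_sub_exp_mul_comp (P := P) hY hY0 (q := fun _ => 1)
        continuous_const (mul_nonneg hk hs.le)
      simpa [mul_assoc] using this
    simp only [hpow]
    have hn : (0 : ℝ) ≤ n := n.cast_nonneg
    have hn1 : (0 : ℝ) ≤ n + 1 := by positivity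
    have hI : ∫ y in Ioi (0 : ℝ), y ^ (-1 - β) * (a * ((1 - Real.exp (-((n + 1 : ℝ) * y))) -
        (1 - Real.exp (-((n : ℝ) * y))))) =
        a * (((n + 1 : ℝ) ^ β - (n : ℝ) ^ β) * (Real.Gamma (1 - β) / β)) := by
      rw [sub_mul, ← integral_rpow_mul_one_sub_exp h0 h1 hn1,
        ← integral_rpow_mul_one_sub_exp h0 h1 hn,
        ← integral_sub (integrableOn_rpow_mul_one_sub_exp h0 h1 hn1)
          (integrableOn_rpow_mul_one_sub_exp h0 h1 hn), ← integral_const_mul]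
      congr 1 with y
      ring
    rw [hI]
    have hlim := ((hscale _ hn1).sub (hscale _ hn)).const_mul a
    have heq : D * (β / Real.Gamma (1 - β)) *
        (a * (((n + 1 : ℝ) ^ β - (n : ℝ) ^ β) * (Real.Gamma (1 - β) / β))) =
        a * ((n + 1 : ℝ) ^ β * D - (n : ℝ) ^ β * D) := by
      field_simp
    rw [heq]
    refine hlim.congr' ?_
    filter_upwards [self_mem_nhdsWithin] with s hs
    rw [integral_const_mul, integral_sub (hbd _ hn1 s hs) (hbd _ hn s hs)]
    ring

theorem tendsto_integral_one_sub_exp_mul_continuous {Ω : Type*} [MeasurableSpace Ω]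
    {P : Measure Ω} [IsProbabilityMeasure P] {Y : Ω → ℝ} (hY : Measurable Y)
    (hY0 : ∀ ω, 0 ≤ Y ω) {β D : ℝ} (h0 : 0 < β) (h1 : β < 1)
    (hL : Tendsto (fun s : ℝ => (∫ ω, (1 - Real.exp (-(s * Y ω))) ∂P) / s ^ β) (𝓝[>] 0) (𝓝 D))
    {q : ℝ → ℝ} (hq : Continuous q) :
    Tendsto (fun s : ℝ => (∫ ω, (1 - Real.exp (-(s * Y ω))) *
        q (Real.exp (-(s * Y ω))) ∂P) / s ^ β) (𝓝[>] 0)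
      (𝓝 (D * (β / Real.Gamma (1 - β)) * ∫ y in Ioi (0 : ℝ),
        y ^ (-1 - β) * ((1 - Real.exp (-y)) * q (Real.exp (-y))))) := by
  choose p hp using fun n : ℕ => exists_polynomial_near_of_continuousOn 0 1 q hq.continuousOn
    (1 / ((n : ℝ) + 1)) Nat.one_div_pos_of_nat
  have hexp : ∀ x : ℝ, 0 ≤ x → Real.exp (-x) ∈ Icc (0 : ℝ) 1 := fun x hx =>
    ⟨(Real.exp_pos _).le, Real.exp_le_one_iff.2 (by linarith)⟩
  have hdiff : ∀ (n : ℕ) (x : ℝ), 0 ≤ x →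
      |(1 - Real.exp (-x)) * (p n).eval (Real.exp (-x)) -
        (1 - Real.exp (-x)) * q (Real.exp (-x))| ≤
      1 / ((n : ℝ) + 1) * (1 - Real.exp (-x)) := fun n x hx => by
    rw [← mul_sub, abs_mul, abs_of_nonneg (by linarith [(hexp x hx).2]), mul_comm]
    exact mul_le_mul_of_nonneg_right (hp n _ (hexp x hx)).le (by linarith [(hexp x hx).2])
  have hone : Tendsto (fun n : ℕ => 1 / ((n : ℝ) + 1)) atTop (𝓝 0) :=
    tendsto_one_div_add_atTop_nhds_zero_nat
  refine TendstoUniformlyOnFilter.tendsto_of_eventually_tendsto (p := atTop)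
    (F := fun (n : ℕ) (s : ℝ) => (∫ ω, (1 - Real.exp (-(s * Y ω))) *
        (p n).eval (Real.exp (-(s * Y ω))) ∂P) / s ^ β) ?_
    (.of_forall fun n => tendsto_integral_one_sub_exp_mul_polynomial hY hY0 h0 h1 hL (p n))
    (Tendsto.const_mul _ ?_)
  · rw [Metric.tendstoUniformlyOnFilter_iff]
    intro ε hε
    have hD : ∀ᶠ s : ℝ in 𝓝[>] 0, (∫ ω, (1 - Real.exp (-(s * Y ω))) ∂P) / s ^ β < |D| + 1 :=
      hL.eventually_lt_const (by linarith [le_abs_self D])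
    have hn : ∀ᶠ n : ℕ in atTop, 1 / ((n : ℝ) + 1) * (|D| + 1) < ε :=
      (hone.mul_const (|D| + 1)).eventually_lt_const (by simpa using hε)
    filter_upwards [hn.prod_mk (hD.and self_mem_nhdsWithin)] with ⟨n, s⟩ ⟨hn, hD, hs⟩
    have hs : 0 < s := hs
    have hsβ := Real.rpow_pos_of_pos hs β
    simp only
    rw [dist_comm, Real.dist_eq, ← sub_div, ← integral_sub
      (integrable_one_sub_exp_mul_comp hY hY0 (p n).continuous hs.le)
      (integrable_one_sub_exp_mul_comp hY hY0 hq hs.le), abs_div, abs_of_pos hsβ]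
    refine lt_of_le_of_lt ?_ hn
    have hbound : |∫ ω, ((1 - Real.exp (-(s * Y ω))) * (p n).eval (Real.exp (-(s * Y ω))) -
        (1 - Real.exp (-(s * Y ω))) * q (Real.exp (-(s * Y ω)))) ∂P| ≤
        1 / ((n : ℝ) + 1) * ∫ ω, (1 - Real.exp (-(s * Y ω))) ∂P := by
      rw [← integral_const_mul, ← Real.norm_eq_abs]
      refine norm_integral_le_of_norm_le
        (g := fun ω => 1 / ((n : ℝ) + 1) * (1 - Real.exp (-(s * Y ω)))) (Integrable.const_mul ?_ _)
        (.of_forall fun ω => hdiff n _ (mul_nonneg hs.le (hY0 ω)))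
      simpa using integrable_one_sub_exp_mul_comp (P := P) hY hY0 (q := fun _ => 1)
        continuous_const hs.le
    calc _ ≤ (1 / ((n : ℝ) + 1) * ∫ ω, (1 - Real.exp (-(s * Y ω))) ∂P) / s ^ β := by gcongr
      _ = 1 / ((n : ℝ) + 1) * ((∫ ω, (1 - Real.exp (-(s * Y ω))) ∂P) / s ^ β) := by ring
      _ ≤ _ := by gcongr
  · have hw := integrableOn_rpow_mul_one_sub_exp h0 h1 zero_le_one
    simp only [one_mul] at hw
    refine tendsto_iff_norm_sub_tendsto_zero.2 (squeeze_zero (fun _ => norm_nonneg _)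
      (g := fun n : ℕ => 1 / ((n : ℝ) + 1) *
        ∫ y in Ioi (0 : ℝ), y ^ (-1 - β) * (1 - Real.exp (-y))) (fun n => ?_)
      (by simpa using hone.mul_const (∫ y in Ioi (0 : ℝ), y ^ (-1 - β) * (1 - Real.exp (-y)))))
    rw [← integral_sub (integrableOn_rpow_mul_one_sub_exp_mul_comp h0 h1 (p n).continuous)
      (integrableOn_rpow_mul_one_sub_exp_mul_comp h0 h1 hq), ← integral_const_mul]
    refine norm_integral_le_of_norm_le (Integrable.const_mul hw _)
      ((ae_restrict_iff' measurableSet_Ioi).2 (.of_forall fun y hy => ?_))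
    have hy : 0 < y := hy
    have h2 := Real.rpow_nonneg hy.le (-1 - β)
    rw [← mul_sub, norm_mul, Real.norm_of_nonneg h2]
    calc _ ≤ y ^ (-1 - β) * (1 / ((n : ℝ) + 1) * (1 - Real.exp (-y))) :=
          mul_le_mul_of_nonneg_left (hdiff n y hy.le) h2
      _ = _ := by ring

theorem exists_continuous_one_sub_mul_eq_indicator {a b : ℝ} (ha : 0 < a) (hab : a < b) :
    ∃ q : ℝ → ℝ, Continuous q ∧
      (∀ x, b ≤ x → (1 - Real.exp (-x)) * q (Real.exp (-x)) = 1) ∧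
      (∀ x, x ≤ a → (1 - Real.exp (-x)) * q (Real.exp (-x)) = 0) ∧
      ∀ x, (1 - Real.exp (-x)) * q (Real.exp (-x)) ∈ Icc (0 : ℝ) 1 := by
  have hA : Real.exp (-a) < 1 := Real.exp_lt_one_iff.2 (by linarith)
  have hAB : Real.exp (-b) < Real.exp (-a) := Real.exp_lt_exp.2 (by linarith)
  set A := Real.exp (-a)
  set B := Real.exp (-b)
  have hden : ∀ t, 0 < max (1 - t) (1 - A) := fun t => lt_max_of_lt_right (by linarith)
  have hzero : ∀ t, A ≤ t → max 0 (min 1 ((A - t) / (A - B))) = 0 := fun t ht => by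
    refine max_eq_left ((min_le_right _ _).trans ?_)
    exact div_nonpos_of_nonpos_of_nonneg (by linarith) (by linarith)
  have hmul : ∀ t, (1 - t) * (max 0 (min 1 ((A - t) / (A - B))) / max (1 - t) (1 - A)) =
      max 0 (min 1 ((A - t) / (A - B))) := fun t => by
    rcases le_total A t with h | h
    · rw [hzero t h]; simp
    · rw [max_eq_left (by linarith : 1 - A ≤ 1 - t)]
      have : 1 - t ≠ 0 := by linarith
      field_simp
  refine ⟨fun t => max 0 (min 1 ((A - t) / (A - B))) / max (1 - t) (1 - A), ?_, ?_, ?_, ?_⟩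
  · exact Continuous.div (by fun_prop) (by fun_prop) fun t => (hden t).ne'
  · intro x hx
    have : Real.exp (-x) ≤ B := Real.exp_le_exp.2 (by linarith)
    simp only [hmul]
    rw [min_eq_left, max_eq_right zero_le_one]
    rw [le_div_iff₀ (by linarith)]
    linarith
  · intro x hx
    simp only [hmul]
    exact hzero _ (Real.exp_le_exp.2 (by linarith))
  · intro x
    simp only [hmul]
    exact ⟨le_max_left _ _, max_le zero_le_one (min_le_left _ _)⟩

/-- **Karamata's Tauberian theorem** for the tail of a nonnegative random variable, with exponent
`0 < β < 1`. -/
theorem tendsto_tail_of_tendsto_laplace {Ω : Type*} [MeasurableSpace Ω]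
    {P : Measure Ω} [IsProbabilityMeasure P] {Y : Ω → ℝ} (hY : Measurable Y)
    (hY0 : ∀ ω, 0 ≤ Y ω) {β D : ℝ} (h0 : 0 < β) (h1 : β < 1)
    (hL : Tendsto (fun s : ℝ => (∫ ω, (1 - Real.exp (-(s * Y ω))) ∂P) / s ^ β) (𝓝[>] 0) (𝓝 D)) :
    Tendsto (fun s : ℝ => P.real {ω | 1 < s * Y ω} / s ^ β) (𝓝[>] 0)
      (𝓝 (D / Real.Gamma (1 - β))) := by
  have hΓ : 0 < Real.Gamma (1 - β) := Real.Gamma_pos_of_pos (by linarith)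
  have hD : 0 ≤ D := by
    refine ge_of_tendsto hL ?_
    filter_upwards [self_mem_nhdsWithin] with s hs
    have hs : 0 < s := hs
    refine div_nonneg (integral_nonneg fun ω => ?_) (Real.rpow_nonneg hs.le _)
    exact sub_nonneg.2 (Real.exp_le_one_iff.2 (by nlinarith [mul_nonneg hs.le (hY0 ω)]))
  have htail : ∀ a : ℝ, 0 < a → ∫ y in Ioi a, y ^ (-1 - β) = a ^ (-β) / β := fun a ha => by
    rw [integral_Ioi_rpow_of_lt (by linarith) ha, show -1 - β + 1 = -β by ring, neg_div_neg_eq]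
  have hmeas : ∀ s : ℝ, MeasurableSet {ω | 1 < s * Y ω} := fun s =>
    measurableSet_lt measurable_const (by fun_prop)
  have hpc : Tendsto (fun x : ℝ => D / Real.Gamma (1 - β) * x ^ (-β)) (𝓝 1)
      (𝓝 (D / Real.Gamma (1 - β))) := by
    have : ContinuousAt (fun x : ℝ => D / Real.Gamma (1 - β) * x ^ (-β)) 1 :=
      continuousAt_const.mul (Real.continuousAt_rpow_const _ _ (Or.inl one_ne_zero))
    simpa using this.tendsto
  have hcoef : 0 ≤ D * (β / Real.Gamma (1 - β)) := by positivity
  refine tendsto_order.2 ⟨fun u hu => ?_, fun u hu => ?_⟩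
  · obtain ⟨b, hub, hb⟩ := (((hpc.mono_left nhdsWithin_le_nhds).eventually_const_lt hu).and
      (self_mem_nhdsWithin (s := Ioi (1 : ℝ)))).exists
    have hb : 1 < b := hb
    obtain ⟨q, hq, hq1, hq0, hq01⟩ := exists_continuous_one_sub_mul_eq_indicator one_pos hb
    have hlim := tendsto_integral_one_sub_exp_mul_continuous hY hY0 h0 h1 hL hq
    have hlow : u < D * (β / Real.Gamma (1 - β)) * ∫ y in Ioi (0 : ℝ),
        y ^ (-1 - β) * ((1 - Real.exp (-y)) * q (Real.exp (-y))) := by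
      refine hub.trans_le ?_
      have hb0 : 0 < b := by linarith
      calc D / Real.Gamma (1 - β) * b ^ (-β) =
          D * (β / Real.Gamma (1 - β)) * ∫ y in Ioi b, y ^ (-1 - β) := by
            rw [htail b hb0]; field_simp
        _ = D * (β / Real.Gamma (1 - β)) * ∫ y in Ioi b,
            y ^ (-1 - β) * ((1 - Real.exp (-y)) * q (Real.exp (-y))) := by
            congr 1
            refine setIntegral_congr_fun measurableSet_Ioi fun y hy => ?_
            rw [hq1 y (le_of_lt hy), mul_one]
        _ ≤ _ := by
            refine mul_le_mul_of_nonneg_left (setIntegral_mono_set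
              (integrableOn_rpow_mul_one_sub_exp_mul_comp h0 h1 hq) ?_
              (Ioi_subset_Ioi hb0.le).eventuallyLE) hcoef
            exact (ae_restrict_iff' measurableSet_Ioi).2 (.of_forall fun y hy =>
              mul_nonneg (Real.rpow_nonneg (le_of_lt hy) _) (hq01 y).1)
    filter_upwards [hlim.eventually_const_lt hlow, self_mem_nhdsWithin] with s hus hs
    have hs : 0 < s := hs
    refine hus.trans_le (div_le_div_of_nonneg_right ?_ (Real.rpow_nonneg hs.le _))
    rw [← integral_indicator_one (hmeas s)]
    refine integral_mono (integrable_one_sub_exp_mul_comp hY hY0 hq hs.le)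
      ((integrable_const 1).indicator (hmeas s)) fun ω => ?_
    by_cases hω : 1 < s * Y ω
    · simpa [indicator_of_mem (show ω ∈ {ω | 1 < s * Y ω} from hω)] using (hq01 (s * Y ω)).2
    · simp [indicator_of_notMem (show ω ∉ {ω | 1 < s * Y ω} from hω), hq0 _ (not_lt.1 hω)]
  · obtain ⟨a, ⟨hua, ha⟩, ha1⟩ := (((hpc.mono_left nhdsWithin_le_nhds).eventually_lt_const hu).and
      ((eventually_gt_nhds zero_lt_one).filter_mono nhdsWithin_le_nhds) |>.and
      (self_mem_nhdsWithin (s := Iio (1 : ℝ)))).exists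
    have ha1 : a < 1 := ha1
    obtain ⟨q, hq, hq1, hq0, hq01⟩ := exists_continuous_one_sub_mul_eq_indicator ha ha1
    have hlim := tendsto_integral_one_sub_exp_mul_continuous hY hY0 h0 h1 hL hq
    have hupp : D * (β / Real.Gamma (1 - β)) * ∫ y in Ioi (0 : ℝ),
        y ^ (-1 - β) * ((1 - Real.exp (-y)) * q (Real.exp (-y))) < u := by
      refine lt_of_le_of_lt ?_ hua
      calc _ = D * (β / Real.Gamma (1 - β)) * ∫ y in Ioi a,
            y ^ (-1 - β) * ((1 - Real.exp (-y)) * q (Real.exp (-y))) := by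
            congr 1
            refine (setIntegral_eq_of_subset_of_forall_sdiff_eq_zero measurableSet_Ioi
              (Ioi_subset_Ioi ha.le) fun y hy => ?_)
            rw [hq0 y (not_lt.1 hy.2), mul_zero]
        _ ≤ D * (β / Real.Gamma (1 - β)) * ∫ y in Ioi a, y ^ (-1 - β) := by
            refine mul_le_mul_of_nonneg_left (setIntegral_mono_on
              ((integrableOn_rpow_mul_one_sub_exp_mul_comp h0 h1 hq).mono_set
                (Ioi_subset_Ioi ha.le)) (integrableOn_Ioi_rpow_of_lt (by linarith) ha)
              measurableSet_Ioi fun y hy => ?_) hcoef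
            exact mul_le_of_le_one_right (Real.rpow_nonneg (ha.trans hy).le _) (hq01 y).2
        _ = _ := by rw [htail a ha]; field_simp
    filter_upwards [hlim.eventually_lt_const hupp, self_mem_nhdsWithin] with s hus hs
    have hs : 0 < s := hs
    refine lt_of_le_of_lt (div_le_div_of_nonneg_right ?_ (Real.rpow_nonneg hs.le _)) hus
    rw [← integral_indicator_one (hmeas s)]
    refine integral_mono ((integrable_const 1).indicator (hmeas s))
      (integrable_one_sub_exp_mul_comp hY hY0 hq hs.le) fun ω => ?_
    by_cases hω : 1 < s * Y ω
    · simp [indicator_of_mem (show ω ∈ {ω | 1 < s * Y ω} from hω), hq1 _ hω.le]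
    · simpa [indicator_of_notMem (show ω ∉ {ω | 1 < s * Y ω} from hω)] using (hq01 (s * Y ω)).1

theorem integral_cos_mul_gaussianReal (u : ℝ) :
    ∫ t, Real.cos (u * t) ∂(ProbabilityTheory.gaussianReal 0 1) = Real.exp (-(u ^ 2 / 2)) := by
  have h := ProbabilityTheory.charFun_gaussianReal (μ := 0) (v := 1) u
  rw [charFun_apply_real] at h
  have hintg : Integrable (fun t : ℝ => Complex.exp (u * t * Complex.I))
      (ProbabilityTheory.gaussianReal 0 1) := by
    refine Integrable.of_bound (C := 1) (Measurable.aestronglyMeasurable (by fun_prop))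
      (.of_forall fun t => ?_)
    have := Complex.norm_exp_ofReal_mul_I (u * t)
    push_cast at this
    exact this.le
  have h2 := congrArg Complex.re h
  have h3 := integral_re hintg
  simp only [RCLike.re_to_complex] at h3
  rw [← h3] at h2
  have h4 : ∀ t : ℝ, (Complex.exp (u * t * Complex.I)).re = Real.cos (u * t) := fun t => by
    rw [← Complex.ofReal_mul, Complex.exp_ofReal_mul_I_re]
  simp only [h4] at h2
  rw [h2]
  have : (u * (0 : ℝ) * Complex.I - ((1 : NNReal) : ℝ) * u ^ 2 / 2 : ℂ) =
      ((-(u ^ 2 / 2) : ℝ) : ℂ) := by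
    push_cast; ring
  rw [this, Complex.exp_ofReal_re]

theorem integral_abs_rpow_gaussianReal {α : ℝ} (hα : 0 < α) :
    ∫ t, |t| ^ α ∂(ProbabilityTheory.gaussianReal 0 1) =
      2 ^ (α / 2) * Real.Gamma ((α + 1) / 2) / √Real.pi := by
  rw [ProbabilityTheory.integral_gaussianReal_eq_integral_smul one_ne_zero]
  have h1 : ∀ t : ℝ, ProbabilityTheory.gaussianPDFReal 0 1 t • |t| ^ α =
      (fun x : ℝ => (√(2 * Real.pi))⁻¹ * (x ^ α * Real.exp (-(1 / 2) * x ^ (2 : ℝ)))) |t| :=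
    fun t => by
    simp only [ProbabilityTheory.gaussianPDFReal, smul_eq_mul, Real.rpow_two, sq_abs]
    simp only [NNReal.coe_one, mul_one, sub_zero]
    rw [show -t ^ 2 / 2 = -(1 / 2) * t ^ 2 by ring]
    ring
  simp only [h1]
  rw [integral_comp_abs (f := fun x : ℝ => (√(2 * Real.pi))⁻¹ *
    (x ^ α * Real.exp (-(1 / 2) * x ^ (2 : ℝ)))), integral_const_mul,
    integral_rpow_mul_exp_neg_mul_rpow two_pos (by linarith) (by norm_num)]
  have h2 : (1 / 2 : ℝ) ^ (-(α + 1) / 2) = 2 ^ (α / 2) * √2 := by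
    rw [one_div, Real.inv_rpow two_pos.le, ← Real.rpow_neg two_pos.le, Real.sqrt_eq_rpow,
      ← Real.rpow_add two_pos]
    ring_nf
  rw [h2, Real.sqrt_mul two_pos.le]
  have : √(2 : ℝ) ≠ 0 := by positivity
  field_simp

theorem tendsto_laplace_sq_of_tendsto_charFun {Ω : Type*} [MeasurableSpace Ω]
    {P : Measure Ω} [IsProbabilityMeasure P] {X : Ω → ℝ} (hX : Measurable X)
    {α C : ℝ} (hα : 0 < α)
    (hφ : Tendsto (fun θ : ℝ => (∫ ω, (1 - Real.cos (θ * X ω)) ∂P) / |θ| ^ α) (𝓝[≠] 0) (𝓝 C)) :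
    Tendsto (fun s : ℝ => (∫ ω, (1 - Real.exp (-(s * X ω ^ 2))) ∂P) / s ^ (α / 2)) (𝓝[>] 0)
      (𝓝 (C * (2 ^ α * Real.Gamma ((α + 1) / 2) / √Real.pi))) := by
  set γ := ProbabilityTheory.gaussianReal 0 1
  set φ : ℝ → ℝ := fun θ => ∫ ω, (1 - Real.cos (θ * X ω)) ∂P with hφdef
  have hprod : ∀ r : ℝ, Integrable (Function.uncurry fun (ω : Ω) (t : ℝ) =>
      1 - Real.cos (r * t * X ω)) (P.prod γ) := fun r => by
    refine Integrable.of_bound (C := 2) (Measurable.aestronglyMeasurable (by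
      unfold Function.uncurry; fun_prop)) (.of_forall fun x => ?_)
    simp only [Function.uncurry, Real.norm_eq_abs]
    rw [abs_le]
    constructor <;> linarith [Real.neg_one_le_cos (r * x.2 * X x.1),
      Real.cos_le_one (r * x.2 * X x.1)]
  have hL : ∀ r : ℝ, ∫ ω, (1 - Real.exp (-(r ^ 2 / 2 * X ω ^ 2))) ∂P = ∫ t, φ (r * t) ∂γ := by
    intro r
    rw [hφdef, ← integral_integral_swap (hprod r)]
    congr 1 with ω
    have hc : ∀ t, r * t * X ω = (r * X ω) * t := fun t => by ring
    simp only [hc]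
    rw [integral_sub (integrable_const _), integral_cos_mul_gaussianReal]
    · simp only [integral_const, probReal_univ, smul_eq_mul, mul_one]
      ring_nf
    · refine Integrable.of_bound (C := 1) (Measurable.aestronglyMeasurable (by fun_prop))
        (.of_forall fun t => Real.abs_cos_le_one _)
  have hφ0 : φ 0 = 0 := by simp [hφdef]
  have hφ2 : ∀ θ, |φ θ| ≤ 2 := fun θ => by
    have := norm_integral_le_of_norm_le_const (μ := P) (f := fun ω => 1 - Real.cos (θ * X ω))
      (C := 2) (.of_forall fun ω => by
        rw [Real.norm_eq_abs, abs_le]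
        constructor <;> linarith [Real.neg_one_le_cos (θ * X ω), Real.cos_le_one (θ * X ω)])
    simpa using this
  have hφm : Measurable φ := by
    refine StronglyMeasurable.measurable (StronglyMeasurable.integral_prod_right'
      (f := fun p : ℝ × Ω => 1 - Real.cos (p.1 * X p.2)) ?_)
    exact Measurable.stronglyMeasurable (by fun_prop)
  obtain ⟨M, hM⟩ : ∃ M : ℝ, ∀ θ, |φ θ| ≤ M * |θ| ^ α := by
    have h1 : ∀ᶠ θ in 𝓝[≠] (0 : ℝ), |φ θ / |θ| ^ α| < |C| + 1 :=
      hφ.abs.eventually_lt_const (by linarith)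
    obtain ⟨δ, hδ, h1⟩ := Metric.eventually_nhds_iff.1 (eventually_nhdsWithin_iff.1 h1)
    have hδα : 0 < δ ^ α := Real.rpow_pos_of_pos hδ α
    refine ⟨(|C| + 1) + 2 / δ ^ α, fun θ => ?_⟩
    rcases eq_or_ne θ 0 with rfl | hθ
    · simp [hφ0, Real.zero_rpow hα.ne']
    have hθα : 0 < |θ| ^ α := Real.rpow_pos_of_pos (abs_pos.2 hθ) α
    rcases lt_or_ge |θ| δ with h | h
    · have h2 := h1 (y := θ) (by simpa using h) hθ
      rw [abs_div, abs_of_pos hθα, div_lt_iff₀ hθα] at h2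
      have : 0 ≤ 2 / δ ^ α * |θ| ^ α := by positivity
      linarith
    · have h2 : δ ^ α ≤ |θ| ^ α := Real.rpow_le_rpow hδ.le h hα.le
      have h3 : 2 ≤ 2 / δ ^ α * |θ| ^ α := by
        rw [div_mul_eq_mul_div, le_div_iff₀ hδα]; linarith
      have h4 : 0 ≤ (|C| + 1) * |θ| ^ α := by positivity
      linarith [hφ2 θ]
  have hdom : Tendsto (fun r : ℝ => ∫ t, φ (r * t) / r ^ α ∂γ) (𝓝[>] 0)
      (𝓝 (∫ t, C * |t| ^ α ∂γ)) := by
    refine tendsto_integral_filter_of_dominated_convergence (fun t => M * |t| ^ α)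
      (.of_forall fun r => Measurable.aestronglyMeasurable (by fun_prop)) ?_ ?_
      (.of_forall fun t => ?_)
    · filter_upwards [self_mem_nhdsWithin] with r hr
      have hr : 0 < r := hr
      have hrα := Real.rpow_pos_of_pos hr α
      refine .of_forall fun t => ?_
      rw [Real.norm_eq_abs, abs_div, abs_of_pos hrα, div_le_iff₀ hrα]
      refine (hM _).trans_eq ?_
      rw [abs_mul, Real.mul_rpow (abs_nonneg _) (abs_nonneg _), abs_of_pos hr]
      ring
    · have := (ProbabilityTheory.memLp_id_gaussianReal (μ := 0) (v := 1)
        α.toNNReal).integrable_norm_rpow (by simpa using hα) (by simp)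
      simp only [id, Real.norm_eq_abs, ENNReal.coe_toReal, Real.coe_toNNReal _ hα.le] at this
      exact this.const_mul M
    · rcases eq_or_ne t 0 with rfl | ht
      · simp [hφ0, Real.zero_rpow hα.ne']
      have hlim : Tendsto (fun r : ℝ => r * t) (𝓝[>] 0) (𝓝[≠] 0) := by
        refine tendsto_nhdsWithin_iff.2 ⟨?_, ?_⟩
        · have : Continuous fun r : ℝ => r * t := by fun_prop
          simpa using (this.tendsto 0).mono_left nhdsWithin_le_nhds
        · filter_upwards [self_mem_nhdsWithin] with r hr
          exact mul_ne_zero (ne_of_gt hr) ht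
      refine ((hφ.comp hlim).mul_const (|t| ^ α)).congr' ?_
      filter_upwards [self_mem_nhdsWithin] with r hr
      have hr : 0 < r := hr
      have h1 := Real.rpow_pos_of_pos hr α
      have h2 := Real.rpow_pos_of_pos (abs_pos.2 ht) α
      simp only [Function.comp]
      rw [abs_mul, Real.mul_rpow (abs_nonneg _) (abs_nonneg _), abs_of_pos hr]
      field_simp
      rfl
  have hr : Tendsto (fun s : ℝ => √(2 * s)) (𝓝[>] 0) (𝓝[>] 0) := by
    refine tendsto_nhdsWithin_iff.2 ⟨?_, ?_⟩
    · have : Continuous fun s : ℝ => √(2 * s) := by fun_prop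
      simpa using (this.tendsto 0).mono_left nhdsWithin_le_nhds
    · filter_upwards [self_mem_nhdsWithin] with s hs
      have hs : 0 < s := hs
      exact Real.sqrt_pos.2 (by positivity)
  have hfin := (hdom.comp hr).const_mul (2 ^ (α / 2))
  rw [integral_const_mul, integral_abs_rpow_gaussianReal hα] at hfin
  have hconst : 2 ^ (α / 2) * (C * (2 ^ (α / 2) * Real.Gamma ((α + 1) / 2) / √Real.pi)) =
      C * (2 ^ α * Real.Gamma ((α + 1) / 2) / √Real.pi) := by
    have : (2 : ℝ) ^ α = 2 ^ (α / 2) * 2 ^ (α / 2) := by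
      rw [← Real.rpow_add two_pos, add_halves]
    rw [this]; ring
  rw [hconst] at hfin
  refine hfin.congr' ?_
  filter_upwards [self_mem_nhdsWithin] with s hs
  have hs : 0 < s := hs
  have h1 := hL (√(2 * s))
  rw [Real.sq_sqrt (by positivity), mul_div_cancel_left₀ s two_ne_zero] at h1
  have h2 : √(2 * s) ^ α = 2 ^ (α / 2) * s ^ (α / 2) := by
    rw [Real.sqrt_eq_rpow, ← Real.rpow_mul (by positivity), Real.mul_rpow two_pos.le hs.le]
    ring_nf
  have h3 := Real.rpow_pos_of_pos two_pos (α / 2)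
  have h4 := Real.rpow_pos_of_pos hs (α / 2)
  simp only [Function.comp]
  rw [integral_div, h1, h2]
  field_simp

theorem tendsto_tail_of_tendsto_charFun {Ω : Type*} [MeasurableSpace Ω]
    {P : Measure Ω} [IsProbabilityMeasure P] {X : Ω → ℝ} (hX : Measurable X)
    {α C : ℝ} (hα : 0 < α) (hα2 : α < 2)
    (hφ : Tendsto (fun θ : ℝ => (∫ ω, (1 - Real.cos (θ * X ω)) ∂P) / |θ| ^ α) (𝓝[≠] 0) (𝓝 C)) :
    Tendsto (fun R : ℝ => P.real {ω | R < |X ω|} / R ^ (-α)) atTop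
      (𝓝 (C * (2 ^ α * Real.Gamma ((α + 1) / 2) / (√Real.pi * Real.Gamma (1 - α / 2))))) := by
  have h1 := tendsto_tail_of_tendsto_laplace (hX.pow_const 2) (fun ω => sq_nonneg (X ω))
    (by linarith : 0 < α / 2) (by linarith) (tendsto_laplace_sq_of_tendsto_charFun hX hα hφ)
  have h2 : Tendsto (fun R : ℝ => (R ^ 2)⁻¹) atTop (𝓝[>] 0) :=
    tendsto_inv_atTop_nhdsGT_zero.comp (tendsto_pow_atTop two_ne_zero)
  have h3 := h1.comp h2
  rw [show C * (2 ^ α * Real.Gamma ((α + 1) / 2) / √Real.pi) / Real.Gamma (1 - α / 2) =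
    C * (2 ^ α * Real.Gamma ((α + 1) / 2) / (√Real.pi * Real.Gamma (1 - α / 2))) by
      rw [mul_div_assoc, div_div]] at h3
  refine h3.congr' ?_
  filter_upwards [eventually_gt_atTop 0] with R hR
  have hset : {ω | 1 < (R ^ 2)⁻¹ * X ω ^ 2} = {ω | R < |X ω|} := by
    ext ω
    rw [mem_ofPred_eq, mem_ofPred_eq, inv_mul_eq_div, lt_div_iff₀ (by positivity), one_mul,
      sq_lt_sq, abs_of_pos hR]
  have hpow : ((R ^ 2)⁻¹) ^ (α / 2) = R ^ (-α) := by
    rw [Real.inv_rpow (by positivity), ← Real.rpow_natCast, ← Real.rpow_mul hR.le,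
      ← Real.rpow_neg hR.le]
    congr 1
    push_cast
    ring
  simp only [Function.comp, hset, hpow]

theorem tendsto_lattice_tail_of_tendsto_cos {p : ℤ → ℝ} (hp0 : ∀ x, 0 ≤ p x) (hp : HasSum p 1)
    {α C : ℝ} (hα : 0 < α) (hα2 : α < 2)
    (hφ : Tendsto (fun θ : ℝ => (1 - ∑' x : ℤ, p x * Real.cos (θ * x)) / |θ| ^ α)
      (𝓝[≠] 0) (𝓝 C)) :
    Tendsto (fun R : ℝ => (∑' x : ℤ, if R < |(x : ℝ)| then p x else 0) / R ^ (-α)) atTop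
      (𝓝 (C * (2 ^ α * Real.Gamma ((α + 1) / 2) / (√Real.pi * Real.Gamma (1 - α / 2))))) := by
  have hsum : HasSum (fun x => ENNReal.ofReal (p x)) 1 := by
    have := hp.summable
    rw [ENNReal.summable.hasSum_iff, ← ENNReal.ofReal_tsum_of_nonneg hp0 this, hp.tsum_eq,
      ENNReal.ofReal_one]
  set Q : PMF ℤ := ⟨fun x => ENNReal.ofReal (p x), hsum⟩
  have hQ : ∀ x, (Q x).toReal = p x := fun x => ENNReal.toReal_ofReal (hp0 x)
  have hcos : ∀ θ : ℝ, Integrable (fun x : ℤ => Real.cos (θ * x)) Q.toMeasure := fun θ =>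
    Integrable.of_bound (C := 1) (Measurable.aestronglyMeasurable (by fun_prop))
      (.of_forall fun t => Real.abs_cos_le_one _)
  have h1 : ∀ θ : ℝ, ∫ x, (1 - Real.cos (θ * x)) ∂Q.toMeasure =
      1 - ∑' x : ℤ, p x * Real.cos (θ * x) := fun θ => by
    rw [integral_sub (integrable_const _) (hcos θ), PMF.integral_eq_tsum _ _ (hcos θ)]
    simp [hQ]
  have h2 : ∀ R : ℝ, Q.toMeasure.real {x : ℤ | R < |(x : ℝ)|} =
      ∑' x : ℤ, if R < |(x : ℝ)| then p x else 0 := fun R => by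
    have hS : MeasurableSet {x : ℤ | R < |(x : ℝ)|} := .of_discrete
    rw [← integral_indicator_one hS, PMF.integral_eq_tsum _ _ ((integrable_const 1).indicator hS)]
    congr 1 with x
    simp [hQ, indicator_apply]
  have h3 := tendsto_tail_of_tendsto_charFun (P := Q.toMeasure) (X := fun x : ℤ => (x : ℝ))
    (by fun_prop) hα hα2 (by simpa only [h1] using hφ)
  simpa only [h2] using h3

theorem tendsto_one_sub_cos_div_sq :
    Tendsto (fun θ : ℝ => (1 - Real.cos θ) / θ ^ 2) (𝓝[≠] 0) (𝓝 (1 / 2)) := by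
  have h : Continuous fun θ : ℝ => Real.sinc (θ / 2) ^ 2 / 2 := by
    have := Real.continuous_sinc
    fun_prop
  have h0 := (h.tendsto 0).mono_left (nhdsWithin_le_nhds (s := {0}ᶜ))
  simp only [zero_div, Real.sinc_zero, one_pow] at h0
  refine h0.congr' ?_
  filter_upwards [self_mem_nhdsWithin] with θ hθ
  have hθ : θ ≠ 0 := hθ
  rw [Real.sinc_of_ne_zero (by simpa using hθ)]
  have h2 : Real.cos θ = 2 * Real.cos (θ / 2) ^ 2 - 1 := by
    rw [← Real.cos_two_mul]
    ring_nf
  rw [div_pow, Real.sin_sq, h2]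
  field_simp
  ring

theorem tendsto_div_abs_rpow_of_cubic {K : ℝ} (hK : 0 < K) {δ p q : ℝ → ℝ}
    (hre : ∀ θ, (1 - δ θ) * (p θ ^ 2 - q θ ^ 2) - δ θ * p θ + δ θ ^ 2 = 0)
    (him : ∀ θ, q θ * (2 * (1 - δ θ) * p θ - δ θ) = 0)
    (hcos : ∀ θ, 2 * p θ + 2 * (p θ ^ 2 - q θ ^ 2) - δ θ = 2 * K * (1 - Real.cos θ))
    (hδ : Tendsto δ (𝓝 0) (𝓝 0)) :
    Tendsto (fun θ => δ θ / |θ| ^ (2 / 3 : ℝ)) (𝓝[≠] 0) (𝓝 (K ^ (1 / 3 : ℝ))) ∧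
    Tendsto (fun θ => p θ / |θ| ^ (2 / 3 : ℝ)) (𝓝[≠] 0) (𝓝 (K ^ (1 / 3 : ℝ) / 2)) := by
  have hδ' := hδ.mono_left (nhdsWithin_le_nhds (s := {(0 : ℝ)}ᶜ))
  have hsmall : ∀ᶠ θ in 𝓝[≠] (0 : ℝ), δ θ < 1 / 2 := hδ'.eventually_lt_const (by norm_num)
  have hcubic : ∀ᶠ θ in 𝓝[≠] (0 : ℝ), 2 * (1 - δ θ) * p θ = δ θ ∧
      (1 - δ θ) ^ 2 * (2 * K * (1 - Real.cos θ)) = δ θ ^ 3 := by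
    filter_upwards [hsmall] with θ h
    have e1 := hre θ
    have e2 := him θ
    rw [← hcos θ]
    rcases mul_eq_zero.1 e2 with hq | hq
    · rw [hq] at e1 ⊢
      have hp0 : p θ = 0 := by
        have : (3 / 4 - δ θ) * p θ ^ 2 ≤ 0 := by nlinarith [sq_nonneg (p θ / 2 - δ θ)]
        have h3 : p θ ^ 2 ≤ 0 := by nlinarith [sq_nonneg (p θ)]
        exact pow_eq_zero_iff two_ne_zero |>.1 (le_antisymm h3 (sq_nonneg _))
      have hd0 : δ θ = 0 := by
        rw [hp0] at e1
        exact pow_eq_zero_iff two_ne_zero |>.1 (by linarith)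
      simp [hp0, hd0]
    · refine ⟨by linarith, ?_⟩
      linear_combination (2 * (1 - δ θ)) * e1 + (1 - δ θ + δ θ) * hq
  have hcube : Tendsto (fun θ => δ θ ^ 3 / θ ^ 2) (𝓝[≠] 0) (𝓝 K) := by
    have h1 := (((hδ'.const_sub 1).pow 2).mul_const (2 * K)).mul tendsto_one_sub_cos_div_sq
    rw [show (1 - 0 : ℝ) ^ 2 * (2 * K) * (1 / 2) = K by ring] at h1
    refine h1.congr' ?_
    filter_upwards [hcubic] with θ h
    rw [← h.2]; ring
  have hmain : Tendsto (fun θ => δ θ / |θ| ^ (2 / 3 : ℝ)) (𝓝[≠] 0) (𝓝 (K ^ (1 / 3 : ℝ))) := by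
    refine (hcube.rpow_const (p := 1 / 3) (Or.inl hK.ne')).congr' ?_
    filter_upwards [hcubic, hsmall] with θ h h2
    have hδ0 : 0 ≤ δ θ := by
      by_contra! hneg
      have h3 : δ θ ^ 3 < 0 := Odd.pow_neg (by decide) hneg
      have h4 : 0 ≤ (1 - δ θ) ^ 2 * (2 * K * (1 - Real.cos θ)) :=
        mul_nonneg (sq_nonneg _) (mul_nonneg (by linarith) (by linarith [Real.cos_le_one θ]))
      linarith [h.2]
    rw [Real.div_rpow (pow_nonneg hδ0 3) (sq_nonneg θ), ← sq_abs, ← Real.rpow_natCast,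
      ← Real.rpow_natCast, ← Real.rpow_mul hδ0, ← Real.rpow_mul (abs_nonneg θ)]
    norm_num
  refine ⟨hmain, ?_⟩
  have h1 := hmain.div ((hδ'.const_sub 1).const_mul 2) (by norm_num)
  rw [show (2 * (1 - 0) : ℝ) = 2 by norm_num] at h1
  refine h1.congr' ?_
  filter_upwards [hcubic, hsmall] with θ h h2
  have h3 : 2 * (1 - δ θ) ≠ 0 := by linarith
  have h4 : p θ = δ θ / (2 * (1 - δ θ)) := by
    rw [eq_div_iff h3]
    linarith [h.1]
  rw [h4, Pi.div_apply, div_right_comm]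

theorem tail_constant_two_thirds :
    (2 : ℝ) ^ (2 / 3 : ℝ) * Real.Gamma ((2 / 3 + 1) / 2) /
      (√Real.pi * Real.Gamma (1 - 2 / 3 / 2)) = √3 * Real.Gamma (2 / 3) / Real.pi := by
  have hdup := Real.Gamma_mul_Gamma_add_half (1 / 3)
  have hrefl := Real.Gamma_mul_Gamma_one_sub (1 / 3)
  rw [show Real.pi * (1 / 3) = Real.pi / 3 by ring, Real.sin_pi_div_three] at hrefl
  norm_num at hdup hrefl ⊢
  have h1 : 0 < Real.Gamma (1 / 3) := Real.Gamma_pos_of_pos (by norm_num)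
  have h2 : 0 < Real.Gamma (2 / 3) := Real.Gamma_pos_of_pos (by norm_num)
  have hpi := Real.pi_pos
  have hs : 0 < √Real.pi := Real.sqrt_pos.2 hpi
  have h3 : (0 : ℝ) < √3 := by positivity
  have h4 : (2 : ℝ) ^ (2 / 3 : ℝ) * 2 ^ (1 / 3 : ℝ) = 2 := by
    rw [← Real.rpow_add two_pos]; norm_num
  have h5 : Real.Gamma (5 / 6) = Real.Gamma (2 / 3) * 2 ^ (1 / 3 : ℝ) * √Real.pi /
      Real.Gamma (1 / 3) := by
    rw [eq_div_iff h1.ne']; linarith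
  have h6 : Real.Gamma (1 / 3) = 2 * Real.pi / (√3 * Real.Gamma (2 / 3)) := by
    rw [eq_div_iff (by positivity)]
    rw [eq_div_iff (by positivity)] at hrefl
    linarith
  rw [h5, h6]
  field_simp
  linear_combination h4

theorem norm_ofReal_mul_zpow {r : ℝ} (hr : 0 ≤ r) {z : ℂ} (hz : ‖z‖ = 1) (n : ℤ) :
    ‖(r : ℂ) * z ^ n‖ = r := by
  rw [norm_mul, norm_zpow, hz, one_zpow, mul_one, Complex.norm_of_nonneg hr]

theorem norm_ofReal_mul_pow {r : ℝ} (hr : 0 ≤ r) {z : ℂ} (hz : ‖z‖ = 1) (n : ℕ) :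
    ‖(r : ℂ) * z ^ n‖ = r := by
  simpa using norm_ofReal_mul_zpow hr hz n

theorem tsum_zpow_eq_of_symm {f : ℤ → ℝ} (hf0 : ∀ x, 0 ≤ f x) (hf : Summable f)
    (hsymm : ∀ x, f (-x) = f x) {z : ℂ} (hz : ‖z‖ = 1) :
    ∑' x : ℤ, (f x : ℂ) * z ^ x =
      ∑' n : ℕ, (f n : ℂ) * z ^ n + ∑' n : ℕ, (f n : ℂ) * z⁻¹ ^ n - f 0 := by
  have hF : Summable fun x : ℤ => (f x : ℂ) * z ^ x :=
    .of_norm (hf.congr fun x => (norm_ofReal_mul_zpow (hf0 x) hz x).symm)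
  have hfn : Summable fun n : ℕ => f n := hf.comp_injective Nat.cast_injective
  have hA : Summable fun n : ℕ => (f n : ℂ) * z ^ n :=
    .of_norm (hfn.congr fun n => (norm_ofReal_mul_pow (hf0 n) hz n).symm)
  have hA' : Summable fun n : ℕ => (f n : ℂ) * z⁻¹ ^ n :=
    .of_norm (hfn.congr fun n => (norm_ofReal_mul_pow (hf0 n) (by simp [hz]) n).symm)
  rw [← hA.tsum_add hA', eq_sub_iff_add_eq]
  have := hF.hasSum.nat_add_neg.tsum_eq
  simp only [zpow_zero, mul_one] at this
  rw [← this]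
  refine tsum_congr fun n => ?_
  rw [hsymm, zpow_natCast, zpow_neg, zpow_natCast, inv_pow]

theorem three_mul_tsum_pow_eq {a b : ℕ → ℝ} (ha0 : ∀ n, 0 ≤ a n) (hb0 : ∀ n, 0 ≤ b n)
    (ha : Summable a) (hb : Summable b) (hb00 : b 0 = 0)
    (hrec : ∀ n, 2 ≤ n → 3 * b n = a n + ∑ k ∈ Finset.HasAntidiagonal.antidiagonal n, b k.1 * b k.2)
    {z : ℂ} (hz : ‖z‖ = 1) :
    3 * ∑' n, (b n : ℂ) * z ^ n =
      ∑' n, (a n : ℂ) * z ^ n - a 0 + (3 * b 1 - a 1) * z + (∑' n, (b n : ℂ) * z ^ n) ^ 2 := by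
  have hAn : Summable fun n : ℕ => ‖(a n : ℂ) * z ^ n‖ :=
    ha.congr fun n => (norm_ofReal_mul_pow (ha0 n) hz n).symm
  have hBn : Summable fun n : ℕ => ‖(b n : ℂ) * z ^ n‖ :=
    hb.congr fun n => (norm_ofReal_mul_pow (hb0 n) hz n).symm
  have hC := (summable_norm_sum_mul_antidiagonal_of_summable_norm hBn hBn).of_norm
  rw [sq, tsum_mul_tsum_eq_tsum_sum_antidiagonal_of_summable_norm hBn hBn]
  have hfin : ∑' n, (3 * ((b n : ℂ) * z ^ n) - (a n : ℂ) * z ^ n -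
      ∑ k ∈ Finset.HasAntidiagonal.antidiagonal n, (b k.1 : ℂ) * z ^ k.1 * ((b k.2 : ℂ) * z ^ k.2)) =
      -(a 0 : ℂ) + (3 * b 1 - a 1) * z := by
    rw [tsum_eq_sum (s := Finset.range 2)]
    · simp [Finset.sum_range_succ, Finset.Nat.antidiagonal_succ, hb00]
      ring
    · intro n hn
      have hn2 : 2 ≤ n := by simpa [Nat.succ_le_iff] using hn
      have hsum : ∑ k ∈ Finset.HasAntidiagonal.antidiagonal n, (b k.1 : ℂ) * z ^ k.1 * ((b k.2 : ℂ) * z ^ k.2) =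
          ((∑ k ∈ Finset.HasAntidiagonal.antidiagonal n, b k.1 * b k.2 : ℝ) : ℂ) * z ^ n := by
        push_cast
        rw [Finset.sum_mul]
        refine Finset.sum_congr rfl fun k hk => ?_
        rw [← Finset.HasAntidiagonal.mem_antidiagonal.1 hk, pow_add]
        ring
      have h := congrArg (fun r : ℝ => (r : ℂ)) (hrec n hn2)
      simp only [Complex.ofReal_mul, Complex.ofReal_add] at h
      rw [hsum]
      push_cast at h ⊢
      linear_combination z ^ n * h
  rw [Summable.tsum_sub ((hBn.of_norm.mul_left 3).sub hAn.of_norm) hC,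
    Summable.tsum_sub (hBn.of_norm.mul_left 3) hAn.of_norm, tsum_mul_left] at hfin
  linear_combination hfin

theorem tsum_neg_natCast_pow_eq {g : ℤ → ℝ} (hgsupp : ∀ y, 0 ≤ y → g y = 0) (z : ℂ) :
    ∑' n : ℕ, (g (-(n : ℤ)) : ℂ) * z ^ n = ∑' y : ℤ, (g y : ℂ) * z ^ (-y) := by
  have hinj : Function.Injective fun n : ℕ => -(n : ℤ) := fun m n h => by simpa using h
  rw [← hinj.tsum_eq]
  · simp
  · intro y hy
    have hy0 : y < 0 := by
      by_contra! h
      exact hy (by simp [hgsupp y h])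
    exact ⟨y.natAbs, by simp only; omega⟩

theorem mul_tsum_zpow_eq {f g : ℤ → ℝ} (hf0 : ∀ x, 0 ≤ f x) (hg0 : ∀ x, 0 ≤ g x)
    (hf : Summable f) (hg : Summable g) (hsymm : ∀ x, f (-x) = f x)
    (hgsupp : ∀ y, 0 ≤ y → g y = 0) {K : ℝ}
    (hrec : ∀ x : ℤ, K * f x = (∑' j : ℕ, f (j + x + 1) * f (-(j : ℤ))) + g (-x - 1))
    {z : ℂ} (hz : ‖z‖ = 1) :
    (K * z - ∑' n : ℕ, (f n : ℂ) * z⁻¹ ^ n) * ∑' x : ℤ, (f x : ℂ) * z ^ x =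
      ∑' n : ℕ, (g (-(n : ℤ)) : ℂ) * z ^ n := by
  have hz0 : z ≠ 0 := norm_ne_zero_iff.1 (by simp [hz])
  have hFn : Summable fun x : ℤ => ‖(f x : ℂ) * z ^ x‖ :=
    hf.congr fun x => (norm_ofReal_mul_zpow (hf0 x) hz x).symm
  have hfn : Summable fun n : ℕ => f n := hf.comp_injective Nat.cast_injective
  have hAn : Summable fun n : ℕ => ‖(f n : ℂ) * z⁻¹ ^ n‖ :=
    hfn.congr fun n => (norm_ofReal_mul_pow (hf0 n) (by simp [hz]) n).symm
  have hGn : Summable fun y : ℤ => (g y : ℂ) * z ^ (-y) :=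
    .of_norm (hg.congr fun y => (norm_ofReal_mul_zpow (hg0 y) hz (-y)).symm)
  have hB := tsum_neg_natCast_pow_eq hgsupp z
  -- the shear `(x, j) ↦ (x + j + 1, j)` turns the correlation into a product
  obtain ⟨e, he⟩ : ∃ e : ℤ × ℕ ≃ ℤ × ℕ, ∀ p, e p = (p.2 + p.1 + 1, p.2) :=
    ⟨{  toFun := fun p => (p.2 + p.1 + 1, p.2)
        invFun := fun p => (p.1 - p.2 - 1, p.2)
        left_inv := fun p => Prod.ext (by dsimp only; ring) rfl
        right_inv := fun p => Prod.ext (by dsimp only; ring) rfl }, fun _ => rfl⟩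
  have hprod : Summable fun p : ℤ × ℕ =>
      ((f p.1 : ℂ) * z ^ p.1) * ((f p.2 : ℂ) * z⁻¹ ^ p.2) := by
    have := summable_mul_of_summable_norm (f := fun x : ℤ => (f x : ℂ) * z ^ x)
      (g := fun n : ℕ => (f n : ℂ) * z⁻¹ ^ n) hFn hAn
    exact this
  have hterm : ∀ (x : ℤ) (j : ℕ), ((f (j + x + 1) : ℂ) * z ^ ((j : ℤ) + x + 1)) *
      ((f j : ℂ) * z⁻¹ ^ j) = ((f (j + x + 1) * f (-(j : ℤ)) : ℝ) : ℂ) * z ^ (x + 1) := by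
    intro x j
    have hzj : z ^ ((j : ℤ) + x + 1) * z⁻¹ ^ j = z ^ (x + 1) := by
      rw [← zpow_natCast, inv_zpow', ← zpow_add₀ hz0]
      congr 1
      ring
    rw [hsymm, ← hzj, Complex.ofReal_mul]
    ring
  have hcorr : Summable fun p : ℤ × ℕ =>
      ((f (p.2 + p.1 + 1) * f (-(p.2 : ℤ)) : ℝ) : ℂ) * z ^ (p.1 + 1) := by
    refine (e.summable_iff.2 hprod).congr fun p => ?_
    rw [Function.comp_apply, he]
    exact hterm p.1 p.2
  have hmul : (∑' x : ℤ, (f x : ℂ) * z ^ x) * ∑' n : ℕ, (f n : ℂ) * z⁻¹ ^ n =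
      ∑' x : ℤ, ((∑' j : ℕ, f (j + x + 1) * f (-(j : ℤ)) : ℝ) : ℂ) * z ^ (x + 1) := by
    rw [tsum_mul_tsum_of_summable_norm hFn hAn, ← e.tsum_eq]
    calc _ = ∑' p : ℤ × ℕ, ((f (p.2 + p.1 + 1) * f (-(p.2 : ℤ)) : ℝ) : ℂ) * z ^ (p.1 + 1) :=
          tsum_congr fun p => by rw [he]; exact hterm p.1 p.2
      _ = _ := by
          rw [hcorr.tsum_prod]
          refine tsum_congr fun x => ?_
          simp only [tsum_mul_right, Complex.ofReal_tsum]
  have hS1 : Summable fun x : ℤ =>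
      ((∑' j : ℕ, f (j + x + 1) * f (-(j : ℤ)) : ℝ) : ℂ) * z ^ (x + 1) := by
    refine hcorr.prod.congr fun x => ?_
    simp only [tsum_mul_right, Complex.ofReal_tsum]
  obtain ⟨r, hr'⟩ : ∃ r : ℤ ≃ ℤ, ∀ x, r x = -x - 1 :=
    ⟨{  toFun := fun x => -x - 1
        invFun := fun x => -x - 1
        left_inv := fun x => by simp
        right_inv := fun x => by simp }, fun _ => rfl⟩
  have hr : ∀ x : ℤ, (g (r x) : ℂ) * z ^ (-(r x)) = (g (-x - 1) : ℂ) * z ^ (x + 1) := fun x => by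
    rw [hr', show -(-x - 1) = x + 1 by ring]
  have hS2 : Summable fun x : ℤ => (g (-x - 1) : ℂ) * z ^ (x + 1) :=
    (r.summable_iff.2 hGn).congr hr
  have hB2 : ∑' y : ℤ, (g y : ℂ) * z ^ (-y) = ∑' x : ℤ, (g (-x - 1) : ℂ) * z ^ (x + 1) := by
    rw [← r.tsum_eq]
    exact tsum_congr hr
  have hK : K * z * ∑' x : ℤ, (f x : ℂ) * z ^ x =
      ∑' x : ℤ, (((∑' j : ℕ, f (j + x + 1) * f (-(j : ℤ)) : ℝ) : ℂ) * z ^ (x + 1) +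
        (g (-x - 1) : ℂ) * z ^ (x + 1)) := by
    rw [← tsum_mul_left]
    refine tsum_congr fun x => ?_
    have h := congrArg (fun r : ℝ => (r : ℂ)) (hrec x)
    simp only [Complex.ofReal_mul, Complex.ofReal_add] at h
    rw [← add_mul, zpow_add_one₀ hz0]
    linear_combination z ^ x * z * h
  rw [hS1.tsum_add hS2, ← hmul, ← hB2, ← hB] at hK
  linear_combination hK

theorem re_mul_exp_ofReal_mul_I_zpow {r θ : ℝ} (n : ℤ) :
    ((r : ℂ) * Complex.exp (θ * Complex.I) ^ n).re = r * Real.cos (θ * n) := by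
  rw [← Complex.exp_int_mul, Complex.re_ofReal_mul,
    show (n : ℂ) * (θ * Complex.I) = ((θ * n : ℝ) : ℂ) * Complex.I by push_cast; ring,
    Complex.exp_ofReal_mul_I_re]

theorem re_tsum_exp_zpow {f : ℤ → ℝ} (hf0 : ∀ x, 0 ≤ f x) (hf : Summable f) (θ : ℝ) :
    (∑' x : ℤ, (f x : ℂ) * Complex.exp (θ * Complex.I) ^ x).re =
      ∑' x : ℤ, f x * Real.cos (θ * x) := by
  rw [Complex.re_tsum (.of_norm (hf.congr fun x =>
    (norm_ofReal_mul_zpow (hf0 x) (Complex.norm_exp_ofReal_mul_I θ) x).symm))]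
  exact tsum_congr fun x => re_mul_exp_ofReal_mul_I_zpow x

theorem tendsto_one_sub_tsum_cos {f : ℤ → ℝ} (hf0 : ∀ x, 0 ≤ f x) (hf : HasSum f 1) :
    Tendsto (fun θ : ℝ => 1 - ∑' x : ℤ, f x * Real.cos (θ * x)) (𝓝 0) (𝓝 0) := by
  have hc : Continuous fun θ : ℝ => ∑' x : ℤ, f x * Real.cos (θ * x) := by
    refine continuous_tsum (fun x => by fun_prop) hf.summable fun x θ => ?_
    rw [norm_mul, Real.norm_of_nonneg (hf0 x)]
    exact mul_le_of_le_one_right (hf0 x) (Real.abs_cos_le_one _)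
  have h := (hc.tendsto 0).const_sub 1
  simpa [hf.tsum_eq] using h

theorem sum_Icc_eq_sum_antidiagonal {g : ℤ → ℝ} (hg : g 0 = 0) {n : ℕ} :
    ∑ j ∈ Finset.Icc (1 : ℤ) (n - 1), g (-n + j) * g (-j) =
      ∑ k ∈ Finset.HasAntidiagonal.antidiagonal n, g (-(k.1 : ℤ)) * g (-(k.2 : ℤ)) := by
  refine Finset.sum_of_injOn (fun j : ℤ => ((n - j).toNat, j.toNat)) ?_ ?_ ?_ ?_
  · intro a ha b hb h
    simp only [Finset.coe_Icc, mem_Icc, Prod.mk.injEq] at ha hb h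
    omega
  · intro a ha
    simp only [Finset.coe_Icc, mem_Icc] at ha
    simp only [Finset.mem_coe, Finset.HasAntidiagonal.mem_antidiagonal]
    omega
  · rintro ⟨a, b⟩ hab hnot
    have hab : a + b = n := Finset.HasAntidiagonal.mem_antidiagonal.1 hab
    rcases a.eq_zero_or_pos with rfl | ha
    · simp [hg]
    rcases b.eq_zero_or_pos with rfl | hb
    · simp [hg]
    exact absurd ⟨b, by simp only [Finset.coe_Icc, mem_Icc]; omega,
      Prod.ext (by dsimp only; omega) (by simp)⟩ hnot
  · intro j hj
    rw [Finset.mem_Icc] at hj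
    dsimp only
    rw [Int.toNat_of_nonneg (by omega), Int.toNat_of_nonneg (by omega), neg_sub',
      sub_neg_eq_add]

/-- The characteristic-function form of the LDP recursive equation. -/
theorem exists_char_eq {f g : ℤ → ℝ}
    (hf0 : ∀ x, 0 ≤ f x) (hg0 : ∀ y, 0 ≤ g y)
    (hfsum : HasSum f 1) (hgsum : HasSum g 1)
    (hfsymm : ∀ x, f (-x) = f x)
    (hgsupp : ∀ y : ℤ, 0 ≤ y → g y = 0)
    (hrec : ∀ x y : ℤ, y ≤ -1 →
      3 * f x * g y =
        f x * f y + f x * (∑ j ∈ Finset.Icc (1 : ℤ) (-y - 1), g (y + j) * g (-j)) +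
          (if y = -1 then (∑' j : ℕ, f ((j : ℤ) + x + 1) * f (-(j : ℤ))) + g (-x - 1)
            else 0)) :
    ∃ K : ℝ, ∀ z : ℂ, ‖z‖ = 1 →
      (∑' x : ℤ, (f x : ℂ) * z ^ x) ^ 2 - (3 * (∑' y : ℤ, (g y : ℂ) * z ^ (-y)) -
        (∑' y : ℤ, (g y : ℂ) * z ^ (-y)) ^ 2) * (∑' x : ℤ, (f x : ℂ) * z ^ x) +
        (∑' y : ℤ, (g y : ℂ) * z ^ (-y)) = 0 ∧
      K * (z + z⁻¹) = 3 * (∑' y : ℤ, (g y : ℂ) * z ^ (-y)) -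
        (∑' y : ℤ, (g y : ℂ) * z ^ (-y)) ^ 2 + (3 * (∑' y : ℤ, (g y : ℂ) * z ^ y) -
        (∑' y : ℤ, (g y : ℂ) * z ^ y) ^ 2) - (∑' x : ℤ, (f x : ℂ) * z ^ x) + f 0 := by
  obtain ⟨x₀, hx₀⟩ : ∃ x, f x ≠ 0 := by
    by_contra! h
    simpa [h] using hfsum.tsum_eq
  have hinj : Function.Injective fun n : ℕ => -(n : ℤ) := fun m n h => by simpa using h
  have ha : Summable fun n : ℕ => f n := hfsum.summable.comp_injective Nat.cast_injective
  have hb : Summable fun n : ℕ => g (-(n : ℤ)) := hgsum.summable.comp_injective hinj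
  have hrec₂ : ∀ n : ℕ, 2 ≤ n → 3 * g (-(n : ℤ)) = f n +
      ∑ k ∈ Finset.HasAntidiagonal.antidiagonal n, g (-(k.1 : ℤ)) * g (-(k.2 : ℤ)) := by
    intro n hn
    have h := hrec x₀ (-(n : ℤ)) (by omega)
    rw [if_neg (by omega), neg_neg, sum_Icc_eq_sum_antidiagonal (hgsupp 0 le_rfl), hfsymm] at h
    apply mul_left_cancel₀ hx₀
    linear_combination h
  have hrec₁ : ∀ x : ℤ, (3 * g (-1) - f 1) * f x =
      (∑' j : ℕ, f (j + x + 1) * f (-(j : ℤ))) + g (-x - 1) := by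
    intro x
    have h := hrec x (-1) le_rfl
    rw [if_pos rfl, hfsymm] at h
    simp only [neg_neg, sub_self, Finset.Icc_eq_empty (show ¬(1 : ℤ) ≤ 0 by norm_num),
      Finset.sum_empty] at h
    linear_combination h
  refine ⟨3 * g (-1) - f 1, fun z hz => ?_⟩
  have hz' : ‖z⁻¹‖ = 1 := by simp [hz]
  have e1 := tsum_zpow_eq_of_symm hf0 hfsum.summable hfsymm hz
  have e2 := three_mul_tsum_pow_eq (a := fun n => f n) (b := fun n => g (-(n : ℤ)))
    (fun n => hf0 _) (fun n => hg0 _) ha hb (hgsupp _ (by simp)) hrec₂ hz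
  have e3 := three_mul_tsum_pow_eq (a := fun n => f n) (b := fun n => g (-(n : ℤ)))
    (fun n => hf0 _) (fun n => hg0 _) ha hb (hgsupp _ (by simp)) hrec₂ hz'
  have e4 := mul_tsum_zpow_eq hf0 hg0 hfsum.summable hgsum.summable hfsymm hgsupp hrec₁ hz
  simp only [tsum_neg_natCast_pow_eq hgsupp, inv_zpow', neg_neg, Nat.cast_zero, Nat.cast_one]
    at e2 e3 e4
  push_cast at e4 ⊢
  constructor
  · linear_combination e4 * (-1) + (∑' x : ℤ, (f x : ℂ) * z ^ x) * (e1 - e2)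
  · linear_combination e1 - e2 - e3

theorem char_real_eqs {f g : ℤ → ℝ}
    (hf0 : ∀ x, 0 ≤ f x) (hg0 : ∀ y, 0 ≤ g y)
    (hfsum : HasSum f 1) (hgsum : HasSum g 1)
    (hfsymm : ∀ x, f (-x) = f x) {K : ℝ}
    (h : ∀ z : ℂ, ‖z‖ = 1 →
      (∑' x : ℤ, (f x : ℂ) * z ^ x) ^ 2 - (3 * (∑' y : ℤ, (g y : ℂ) * z ^ (-y)) -
        (∑' y : ℤ, (g y : ℂ) * z ^ (-y)) ^ 2) * (∑' x : ℤ, (f x : ℂ) * z ^ x) +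
        (∑' y : ℤ, (g y : ℂ) * z ^ (-y)) = 0 ∧
      K * (z + z⁻¹) = 3 * (∑' y : ℤ, (g y : ℂ) * z ^ (-y)) -
        (∑' y : ℤ, (g y : ℂ) * z ^ (-y)) ^ 2 + (3 * (∑' y : ℤ, (g y : ℂ) * z ^ y) -
        (∑' y : ℤ, (g y : ℂ) * z ^ y) ^ 2) - (∑' x : ℤ, (f x : ℂ) * z ^ x) + f 0) :
    K = (3 + f 0) / 2 ∧ ∃ q : ℝ → ℝ, ∀ θ,
      (1 - (1 - ∑' x : ℤ, f x * Real.cos (θ * x))) *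
        ((1 - ∑' y : ℤ, g y * Real.cos (θ * y)) ^ 2 - q θ ^ 2) -
        (1 - ∑' x : ℤ, f x * Real.cos (θ * x)) * (1 - ∑' y : ℤ, g y * Real.cos (θ * y)) +
        (1 - ∑' x : ℤ, f x * Real.cos (θ * x)) ^ 2 = 0 ∧
      q θ * (2 * (1 - (1 - ∑' x : ℤ, f x * Real.cos (θ * x))) *
        (1 - ∑' y : ℤ, g y * Real.cos (θ * y)) - (1 - ∑' x : ℤ, f x * Real.cos (θ * x))) = 0 ∧
      2 * (1 - ∑' y : ℤ, g y * Real.cos (θ * y)) +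
        2 * ((1 - ∑' y : ℤ, g y * Real.cos (θ * y)) ^ 2 - q θ ^ 2) -
        (1 - ∑' x : ℤ, f x * Real.cos (θ * x)) = 2 * K * (1 - Real.cos θ) := by
  have hK : K = (3 + f 0) / 2 := by
    have h1 := (h 1 (by simp)).2
    simp only [one_zpow, mul_one, ← Complex.ofReal_tsum, hfsum.tsum_eq, hgsum.tsum_eq] at h1
    norm_num at h1
    have h2 : K * 2 = 3 + f 0 := by
      apply Complex.ofReal_injective
      push_cast
      linear_combination h1
    linarith
  refine ⟨hK, fun θ => (∑' y : ℤ, (g y : ℂ) * Complex.exp (θ * Complex.I) ^ y).im, fun θ => ?_⟩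
  have hz := Complex.norm_exp_ofReal_mul_I θ
  have hconj : (starRingEnd ℂ) (Complex.exp (θ * Complex.I)) =
      (Complex.exp (θ * Complex.I))⁻¹ := by
    rw [← Complex.exp_conj, ← Complex.exp_neg]; simp
  have hzz : Complex.exp (θ * Complex.I) + (Complex.exp (θ * Complex.I))⁻¹ =
      ((2 * Real.cos θ : ℝ) : ℂ) := by
    rw [← Complex.exp_neg]
    push_cast
    rw [Complex.two_cos, neg_mul]
  have hFre := re_tsum_exp_zpow hf0 hfsum.summable θ
  have hGre := re_tsum_exp_zpow hg0 hgsum.summable θ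
  have hconjt : ∀ p : ℤ → ℝ, ∑' y : ℤ, (p y : ℂ) * Complex.exp (θ * Complex.I) ^ (-y) =
      (starRingEnd ℂ) (∑' y : ℤ, (p y : ℂ) * Complex.exp (θ * Complex.I) ^ y) := by
    intro p
    rw [Complex.conj_tsum]
    refine tsum_congr fun y => ?_
    rw [map_mul, map_zpow₀, hconj, Complex.conj_ofReal, inv_zpow']
  have hFim : (∑' x : ℤ, (f x : ℂ) * Complex.exp (θ * Complex.I) ^ x).im = 0 := by
    rw [← Complex.conj_eq_iff_im, ← hconjt, ← (Equiv.neg ℤ).tsum_eq]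
    simp [hfsymm]
  obtain ⟨e1, e2⟩ := h _ hz
  rw [hconjt g] at e1 e2
  rw [hzz] at e2
  rw [← hFre, ← hGre]
  dsimp only
  generalize (∑' x : ℤ, (f x : ℂ) * Complex.exp (θ * Complex.I) ^ x) = F at *
  generalize (∑' x : ℤ, (g x : ℂ) * Complex.exp (θ * Complex.I) ^ x) = G at *
  have r1 := congrArg Complex.re e1
  have i1 := congrArg Complex.im e1
  have r2 := congrArg Complex.re e2
  simp [pow_two, hFim, Complex.cos_ofReal_re] at r1 i1 r2
  refine ⟨?_, ?_, ?_⟩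
  · linear_combination r1
  · linear_combination i1
  · linear_combination r2 - 2 * hK


theorem tsum_lt_neg_eq {g : ℤ → ℝ} (hgsupp : ∀ y : ℤ, 0 ≤ y → g y = 0) (R : ℝ) :
    (∑' y : ℤ, if (y : ℝ) < -R then g y else 0) = ∑' y : ℤ, if R < |(y : ℝ)| then g y else 0 := by
  refine tsum_congr fun y => ?_
  rcases le_or_gt 0 y with hy | hy
  · simp [hgsupp y hy]
  · have : (y : ℝ) < 0 := by exact_mod_cast hy
    simp only [abs_of_neg this, lt_neg]

theorem isLittleO_sub_of_tendsto_div_rpow {u : ℝ → ℝ} {c s : ℝ}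
    (h : Tendsto (fun R => u R / R ^ s) atTop (𝓝 c)) :
    (fun R => u R - c * R ^ s) =o[atTop] fun R : ℝ => R ^ s := by
  have hne : ∀ᶠ R : ℝ in atTop, R ^ s ≠ 0 := by
    filter_upwards [eventually_gt_atTop 0] with R hR using (Real.rpow_pos_of_pos hR s).ne'
  rw [isLittleO_iff_tendsto' (hne.mono fun R hR h0 => absurd h0 hR)]
  have h1 := h.sub_const c
  rw [sub_self] at h1
  refine h1.congr' ?_
  filter_upwards [hne] with R hR
  rw [sub_div, mul_div_cancel_right₀ _ hR]

end

/-- Suppose `(f, g)` satisfies the LDP recursive equation, and set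
`c₁ = (√3 Γ(2/3)/(2π)) ((3 + f 0)/2)^{1/3} > 0`.  Then as `R → ∞`,
`Σ_{|x| > R} f(x) = 2 c₁ R^{-2/3} + o(R^{-2/3})` and
`Σ_{y < -R} g(y) = c₁ R^{-2/3} + o(R^{-2/3})`. -/
theorem stmt_10
    (f g : ℤ → ℝ)
    (hf0 : ∀ x, 0 ≤ f x) (hg0 : ∀ y, 0 ≤ g y)
    (hfsum : HasSum f 1) (hgsum : HasSum g 1)
    (hfsymm : ∀ x, f (-x) = f x)
    (hgsupp : ∀ y : ℤ, 0 ≤ y → g y = 0)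
    (hrec : ∀ x y : ℤ, y ≤ -1 →
      3 * f x * g y =
        f x * f y + f x * (∑ j ∈ Finset.Icc (1 : ℤ) (-y - 1), g (y + j) * g (-j)) +
          (if y = -1 then (∑' j : ℕ, f ((j : ℤ) + x + 1) * f (-(j : ℤ))) + g (-x - 1)
            else 0))
    (c₁ : ℝ)
    (hc₁ : c₁ = Real.sqrt 3 * Real.Gamma (2 / 3) / (2 * Real.pi) *
      ((3 + f 0) / 2) ^ ((1 : ℝ) / 3)) :
    0 < c₁ ∧
    ((fun R : ℝ => (∑' x : ℤ, if R < |(x : ℝ)| then f x else 0) -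
        2 * c₁ * R ^ (-2 / 3 : ℝ))
      =o[atTop] fun R : ℝ => R ^ (-2 / 3 : ℝ)) ∧
    ((fun R : ℝ => (∑' y : ℤ, if (y : ℝ) < -R then g y else 0) -
        c₁ * R ^ (-2 / 3 : ℝ))
      =o[atTop] fun R : ℝ => R ^ (-2 / 3 : ℝ)) := by
  obtain ⟨K, hchar⟩ := exists_char_eq hf0 hg0 hfsum hgsum hfsymm hgsupp hrec
  obtain ⟨rfl, q, hq⟩ := char_real_eqs hf0 hg0 hfsum hgsum hfsymm hchar
  have hK : 0 < (3 + f 0) / 2 := by linarith [hf0 0]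
  obtain ⟨hφ, hψ⟩ := tendsto_div_abs_rpow_of_cubic hK (fun θ => (hq θ).1) (fun θ => (hq θ).2.1)
    (fun θ => (hq θ).2.2) (tendsto_one_sub_tsum_cos hf0 hfsum)
  have hf := tendsto_lattice_tail_of_tendsto_cos hf0 hfsum (by norm_num) (by norm_num) hφ
  have hg := tendsto_lattice_tail_of_tendsto_cos hg0 hgsum (by norm_num) (by norm_num) hψ
  rw [tail_constant_two_thirds] at hf hg
  have hexp : (-2 / 3 : ℝ) = -(2 / 3) := by norm_num
  have hcf : ((3 + f 0) / 2) ^ (1 / 3 : ℝ) * (√3 * Real.Gamma (2 / 3) / Real.pi) = 2 * c₁ := by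
    rw [hc₁]
    field_simp
  have hcg : ((3 + f 0) / 2) ^ (1 / 3 : ℝ) / 2 * (√3 * Real.Gamma (2 / 3) / Real.pi) = c₁ := by
    linarith
  rw [hcf] at hf
  rw [hcg] at hg
  refine ⟨?_, ?_, ?_⟩
  · have hΓ : 0 < Real.Gamma (2 / 3) := Real.Gamma_pos_of_pos (by norm_num)
    have hpi := Real.pi_pos
    rw [hc₁]
    positivity
  · rw [hexp]
    exact isLittleO_sub_of_tendsto_div_rpow hf
  · rw [hexp]
    simp only [tsum_lt_neg_eq hgsupp]
    exact isLittleO_sub_of_tendsto_div_rpow hg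
end

section
/- Let X be a non-negative integer-valued random variable with characteristic function φ(t) = 𝔼[e^{itX}]. Suppose there exist c ∈ ℂ with Re(c) ≠ 0 and ν ∈ (0,1) such that φ(t) = 1 + (c·𝟙_{t>0} + c̄·𝟙_{t<0})·|t|^ν + o(|t|^ν) as t → 0. Then necessarily Re(c) < 0 and Im(c) > 0, and, setting a = −(Re(c)/Γ(1−ν))·sec(πν/2) > 0, one has ℙ[X > R] = a·R^{−ν} + o(R^{−ν}) as R → ∞. -/
open MeasureTheory Complex Asymptotics Filter Topology

section AuxiliaryLemmas

open Set

/-- The kernel `(1 - cos v) v ^ (ν - 2)` is integrable on the half-line for `0 ≤ ν < 1`. -/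
theorem integrableOn_one_sub_cos_mul_rpow {ν : ℝ} (hν0 : 0 ≤ ν) (hν1 : ν < 1) :
    IntegrableOn (fun v : ℝ => (1 - Real.cos v) * v ^ (ν - 2)) (Ioi 0) := by
  have hmeas : Measurable fun v : ℝ => (1 - Real.cos v) * v ^ (ν - 2) := by fun_prop
  rw [← Ioc_union_Ioi_eq_Ioi (zero_le_one' ℝ)]
  refine IntegrableOn.union ?_ ?_
  · have h : IntegrableOn (fun v : ℝ => v ^ ν) (Ioc 0 1) :=
      (intervalIntegrable_iff_integrableOn_Ioc_of_le zero_le_one).1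
        (intervalIntegral.intervalIntegrable_rpow' (by linarith))
    refine h.mono' hmeas.aestronglyMeasurable ?_
    filter_upwards [ae_restrict_mem measurableSet_Ioc] with v hv
    have hv0 : 0 < v := hv.1
    rw [Real.norm_of_nonneg (mul_nonneg (by linarith [Real.cos_le_one v]) (by positivity))]
    calc (1 - Real.cos v) * v ^ (ν - 2) ≤ v ^ 2 * v ^ (ν - 2) := by
          gcongr
          nlinarith [Real.one_sub_sq_div_two_le_cos (x := v), sq_nonneg v]
      _ = v ^ ν := by
          rw [← Real.rpow_natCast, ← Real.rpow_add hv0]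
          norm_num
  · have h : IntegrableOn (fun v : ℝ => 2 * v ^ (ν - 2)) (Ioi 1) :=
      (integrableOn_Ioi_rpow_of_lt (by linarith) one_pos).const_mul 2
    refine h.mono' hmeas.aestronglyMeasurable ?_
    filter_upwards [ae_restrict_mem measurableSet_Ioi] with v hv
    have hv0 : 0 < v := one_pos.trans hv
    rw [Real.norm_of_nonneg (mul_nonneg (by linarith [Real.cos_le_one v]) (by positivity))]
    gcongr
    linarith [Real.neg_one_le_cos v]

theorem exp_mul_complex_re_im (y x t : ℝ) :
    cexp ((-y + x * I) * t) = ((Real.exp (-(t * y)) * Real.cos (x * t) : ℝ) : ℂ)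
      + ((Real.exp (-(t * y)) * Real.sin (x * t) : ℝ) : ℂ) * I := by
  have : ((-y + x * I) * t : ℂ) = ((-(t * y) : ℝ) : ℂ) + ((x * t : ℝ) : ℂ) * I := by
    push_cast; ring
  rw [this, Complex.exp_add, Complex.exp_mul_I]
  push_cast
  ring

theorem integrableOn_exp_neg_mul_complex {y : ℝ} (hy : 0 < y) (x : ℝ) :
    IntegrableOn (fun t : ℝ => cexp ((-y + x * I) * t)) (Ioi 0) :=
  integrableOn_exp_mul_complex_Ioi (by simpa using hy) 0

theorem integral_exp_neg_mul_complex {y : ℝ} (hy : 0 < y) (x : ℝ) :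
    ∫ t : ℝ in Ioi 0, cexp ((-y + x * I) * t)
      = ((y / (y ^ 2 + x ^ 2) : ℝ) : ℂ) + ((x / (y ^ 2 + x ^ 2) : ℝ) : ℂ) * I := by
  have hp : y ^ 2 + x ^ 2 ≠ 0 := by positivity
  have hp' : (y : ℂ) ^ 2 + (x : ℂ) ^ 2 ≠ 0 := by exact_mod_cast hp
  have hne : (-y + x * I : ℂ) ≠ 0 := fun h => hy.ne' (by simpa using congrArg Complex.re h)
  rw [integral_exp_mul_complex_Ioi (by simpa using hy) 0]
  push_cast
  simp only [mul_zero, Complex.exp_zero]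
  field_simp
  linear_combination (-(x : ℂ) ^ 2) * I_sq

theorem integrableOn_exp_neg_mul_cos {y : ℝ} (hy : 0 < y) (x : ℝ) :
    IntegrableOn (fun t : ℝ => Real.exp (-(t * y)) * Real.cos (x * t)) (Ioi 0) := by
  refine (integrableOn_exp_neg_mul_complex hy x).re.congr (ae_of_all _ fun t => ?_)
  simp [exp_mul_complex_re_im, -ofReal_mul]

theorem integral_exp_neg_mul_cos {y : ℝ} (hy : 0 < y) (x : ℝ) :
    ∫ t : ℝ in Ioi 0, Real.exp (-(t * y)) * Real.cos (x * t) = y / (y ^ 2 + x ^ 2) := by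
  have h := integral_re (integrableOn_exp_neg_mul_complex hy x)
  rw [integral_exp_neg_mul_complex hy x] at h
  simpa [exp_mul_complex_re_im, -ofReal_mul, -ofReal_div] using h

theorem integral_exp_neg_mul_sin {y : ℝ} (hy : 0 < y) (x : ℝ) :
    ∫ t : ℝ in Ioi 0, Real.exp (-(t * y)) * Real.sin (x * t) = x / (y ^ 2 + x ^ 2) := by
  have h := integral_im (integrableOn_exp_neg_mul_complex hy x)
  rw [integral_exp_neg_mul_complex hy x] at h
  simpa [exp_mul_complex_re_im, -ofReal_mul, -ofReal_div] using h

theorem integral_one_sub_cos_mul_exp {y : ℝ} (hy : 0 < y) :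
    ∫ v : ℝ in Ioi 0, (1 - Real.cos v) * Real.exp (-(y * v)) = (y * (1 + y ^ 2))⁻¹ := by
  have h0 := integral_exp_neg_mul_cos hy 0
  have h1 := integral_exp_neg_mul_cos hy 1
  have := integral_sub (integrableOn_exp_neg_mul_cos hy 0) (integrableOn_exp_neg_mul_cos hy 1)
  rw [h0, h1] at this
  have e : ∀ v : ℝ, (1 - Real.cos v) * Real.exp (-(y * v))
      = Real.exp (-(v * y)) * Real.cos (0 * v) - Real.exp (-(v * y)) * Real.cos (1 * v) := by
    intro v
    rw [zero_mul, one_mul, Real.cos_zero, mul_comm y v]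
    ring
  simp_rw [e]
  rw [this]
  field_simp
  ring

/-- Mellin transform of `1 / (1 + y ^ 2)`. -/
theorem integral_rpow_neg_div_one_add_sq {ν : ℝ} (hν0 : 0 ≤ ν) (hν1 : ν < 1) :
    ∫ y : ℝ in Ioi 0, y ^ (-ν) * (1 + y ^ 2)⁻¹ = Real.pi / (2 * Real.cos (Real.pi * ν / 2)) := by
  have inner_y : ∀ t ∈ Ioi (0 : ℝ), ∫ y : ℝ in Ioi 0, y ^ (-ν) * Real.exp (-(t * (1 + y ^ 2)))
      = Real.exp (-t) * t ^ ((1 + ν) / 2 - 1) * (Real.Gamma ((1 - ν) / 2) / 2) := by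
    intro t ht
    have h := integral_rpow_mul_exp_neg_mul_rpow (p := 2) (q := -ν) (b := t) two_pos
      (by linarith) ht
    have e : ∀ y : ℝ, y ^ (-ν) * Real.exp (-(t * (1 + y ^ 2)))
        = Real.exp (-t) * (y ^ (-ν) * Real.exp (-t * y ^ (2 : ℝ))) := by
      intro y
      rw [show -(t * (1 + y ^ 2)) = -t + -t * y ^ (2 : ℝ) by rw [Real.rpow_two]; ring,
        Real.exp_add]
      ring
    simp_rw [e]
    rw [integral_const_mul, h, show -(-ν + 1) / 2 = (1 + ν) / 2 - 1 by ring,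
      show (-ν + 1) / 2 = (1 - ν) / 2 by ring]
    ring
  have inner_t : ∀ y : ℝ, ∫ t : ℝ in Ioi 0, y ^ (-ν) * Real.exp (-(t * (1 + y ^ 2)))
      = y ^ (-ν) * (1 + y ^ 2)⁻¹ := by
    intro y
    have h := integral_exp_neg_mul_cos (y := 1 + y ^ 2) (by positivity) 0
    rw [integral_const_mul]
    simp only [zero_mul, Real.cos_zero, mul_one] at h
    rw [h]
    congr 1
    have : 1 + y ^ 2 ≠ 0 := by positivity
    field_simp
    ring
  have hint : Integrable (Function.uncurry fun y t : ℝ =>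
      y ^ (-ν) * Real.exp (-(t * (1 + y ^ 2))))
      ((volume.restrict (Ioi 0)).prod (volume.restrict (Ioi 0))) := by
    have hm : Measurable (Function.uncurry fun y t : ℝ =>
      y ^ (-ν) * Real.exp (-(t * (1 + y ^ 2)))) := by
      unfold Function.uncurry; fun_prop
    refine (integrable_prod_iff' hm.aestronglyMeasurable).2 ⟨?_, ?_⟩
    · filter_upwards [ae_restrict_mem measurableSet_Ioi] with t ht
      refine Integrable.of_integral_ne_zero ?_
      simp only [Function.uncurry]
      rw [inner_y t ht]
      have := Real.Gamma_pos_of_pos (s := (1 - ν) / 2) (by linarith)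
      have ht' : 0 < t := ht
      positivity
    · have h := (Real.GammaIntegral_convergent (s := (1 + ν) / 2) (by linarith)).mul_const
        (Real.Gamma ((1 - ν) / 2) / 2)
      refine h.congr ?_
      filter_upwards [ae_restrict_mem measurableSet_Ioi] with t ht
      rw [← inner_y t ht]
      refine setIntegral_congr_fun measurableSet_Ioi fun y hy => ?_
      have hy' : (0 : ℝ) < y := hy
      simp only [Function.uncurry]
      rw [Real.norm_of_nonneg (by positivity)]
  have key := integral_integral_swap hint
  simp_rw [inner_t] at key
  rw [key, setIntegral_congr_fun measurableSet_Ioi inner_y, integral_mul_const,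
    ← Real.Gamma_eq_integral (by linarith)]
  have hrefl := Real.Gamma_mul_Gamma_one_sub ((1 + ν) / 2)
  rw [show 1 - (1 + ν) / 2 = (1 - ν) / 2 by ring,
    show Real.pi * ((1 + ν) / 2) = Real.pi * ν / 2 + Real.pi / 2 by ring,
    Real.sin_add_pi_div_two] at hrefl
  rw [mul_div_assoc', hrefl, div_div, mul_comm (Real.cos _)]

theorem cos_pi_mul_div_two_pos {ν : ℝ} (hν0 : 0 ≤ ν) (hν1 : ν < 1) :
    0 < Real.cos (Real.pi * ν / 2) := by
  apply Real.cos_pos_of_mem_Ioo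
  constructor <;> nlinarith [Real.pi_pos]

theorem integral_one_sub_cos_mul_rpow {ν : ℝ} (hν0 : 0 ≤ ν) (hν1 : ν < 1) :
    ∫ v : ℝ in Ioi 0, (1 - Real.cos v) * v ^ (ν - 2)
      = Real.pi / (2 * Real.Gamma (2 - ν) * Real.cos (Real.pi * ν / 2)) := by
  have hG : 0 < Real.Gamma (2 - ν) := Real.Gamma_pos_of_pos (by linarith)
  have inner_y : ∀ v ∈ Ioi (0 : ℝ),
      ∫ y : ℝ in Ioi 0, (1 - Real.cos v) * (y ^ (1 - ν) * Real.exp (-(v * y)))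
        = (1 - Real.cos v) * v ^ (ν - 2) * Real.Gamma (2 - ν) := by
    intro v hv
    have hv' : (0 : ℝ) < v := hv
    have h := Real.integral_rpow_mul_exp_neg_mul_Ioi (a := 2 - ν) (by linarith) hv
    rw [show 2 - ν - 1 = 1 - ν by ring] at h
    rw [integral_const_mul, h, one_div, Real.inv_rpow hv'.le, ← Real.rpow_neg hv'.le, neg_sub,
      mul_assoc]
  have inner_v : ∀ y ∈ Ioi (0 : ℝ),
      ∫ v : ℝ in Ioi 0, (1 - Real.cos v) * (y ^ (1 - ν) * Real.exp (-(v * y)))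
        = y ^ (-ν) * (1 + y ^ 2)⁻¹ := by
    intro y hy
    have hy' : (0 : ℝ) < y := hy
    have e : ∀ v : ℝ, (1 - Real.cos v) * (y ^ (1 - ν) * Real.exp (-(v * y)))
        = y ^ (1 - ν) * ((1 - Real.cos v) * Real.exp (-(y * v))) := by
      intro v; rw [mul_comm v y]; ring
    simp_rw [e]
    rw [integral_const_mul, integral_one_sub_cos_mul_exp hy', mul_inv, ← mul_assoc,
      ← Real.rpow_neg_one y, ← Real.rpow_add hy', show 1 - ν + -1 = -ν by ring]
  have hint : Integrable (Function.uncurry fun v y : ℝ =>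
      (1 - Real.cos v) * (y ^ (1 - ν) * Real.exp (-(v * y))))
      ((volume.restrict (Ioi 0)).prod (volume.restrict (Ioi 0))) := by
    have hm : Measurable (Function.uncurry fun v y : ℝ =>
      (1 - Real.cos v) * (y ^ (1 - ν) * Real.exp (-(v * y)))) := by
      unfold Function.uncurry; fun_prop
    refine (integrable_prod_iff hm.aestronglyMeasurable).2 ⟨?_, ?_⟩
    · filter_upwards [ae_restrict_mem measurableSet_Ioi] with v hv
      have hv' : (0 : ℝ) < v := hv
      have h := Real.integral_rpow_mul_exp_neg_mul_Ioi (a := 2 - ν) (by linarith) hv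
      rw [show 2 - ν - 1 = 1 - ν by ring] at h
      have hi : IntegrableOn (fun y : ℝ => y ^ (1 - ν) * Real.exp (-(v * y))) (Ioi 0) :=
        Integrable.of_integral_ne_zero (by rw [h]; positivity)
      exact Integrable.const_mul hi (1 - Real.cos v)
    · refine ((integrableOn_one_sub_cos_mul_rpow hν0 hν1).mul_const (Real.Gamma (2 - ν))).congr ?_
      filter_upwards [ae_restrict_mem measurableSet_Ioi] with v hv
      rw [← inner_y v hv]
      refine setIntegral_congr_fun measurableSet_Ioi fun y hy => ?_
      have hy' : (0 : ℝ) < y := hy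
      simp only [Function.uncurry]
      rw [Real.norm_of_nonneg
        (mul_nonneg (by linarith [Real.cos_le_one v]) (by positivity))]
  have key := integral_integral_swap hint
  rw [setIntegral_congr_fun measurableSet_Ioi inner_y,
    setIntegral_congr_fun measurableSet_Ioi inner_v, integral_mul_const,
    integral_rpow_neg_div_one_add_sq hν0 hν1] at key
  have := cos_pi_mul_div_two_pos hν0 hν1
  field_simp at key ⊢
  linarith

theorem integrableOn_one_sub_cos_div_sq :
    IntegrableOn (fun v : ℝ => (1 - Real.cos v) / v ^ 2) (Ioi 0) := by
  refine (integrableOn_one_sub_cos_mul_rpow le_rfl zero_lt_one).congr_fun (fun v hv => ?_)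
    measurableSet_Ioi
  have hv' : (0 : ℝ) < v := hv
  simp only [zero_sub]
  rw [Real.rpow_neg hv'.le, Real.rpow_two, div_eq_mul_inv]

theorem integral_one_sub_cos_div_sq :
    ∫ v : ℝ in Ioi 0, (1 - Real.cos v) / v ^ 2 = Real.pi / 2 := by
  have h := integral_one_sub_cos_mul_rpow le_rfl zero_lt_one
  simp only [sub_zero, mul_zero, zero_div, Real.cos_zero, mul_one, Real.Gamma_two] at h
  rw [← h]
  refine setIntegral_congr_fun measurableSet_Ioi fun v hv => ?_
  have hv' : (0 : ℝ) < v := hv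
  simp only [zero_sub]
  rw [Real.rpow_neg hv'.le, Real.rpow_two, div_eq_mul_inv]

theorem integrableOn_one_sub_cos_mul_div_sq (b : ℝ) :
    IntegrableOn (fun v : ℝ => (1 - Real.cos (b * v)) / v ^ 2) (Ioi 0) := by
  wlog hb : 0 < b generalizing b
  · rcases (not_lt.1 hb).eq_or_lt with rfl | hb
    · simp
    · simpa using this (-b) (by linarith)
  have h := (integrableOn_Ioi_comp_mul_left_iff
    (fun v : ℝ => (1 - Real.cos v) / v ^ 2) 0 hb).2
      (by simpa using integrableOn_one_sub_cos_div_sq)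
  refine (Integrable.const_mul h (b ^ 2)).congr (ae_of_all _ fun v => ?_)
  simp only [mul_pow]
  field_simp

theorem integral_one_sub_cos_mul_div_sq (b : ℝ) :
    ∫ v : ℝ in Ioi 0, (1 - Real.cos (b * v)) / v ^ 2 = Real.pi / 2 * |b| := by
  wlog hb : 0 < b generalizing b
  · rcases (not_lt.1 hb).eq_or_lt with rfl | hb
    · simp
    · simpa using this (-b) (by linarith)
  have h := integral_comp_mul_left_Ioi (fun v : ℝ => (1 - Real.cos v) / v ^ 2) 0 hb
  rw [mul_zero, integral_one_sub_cos_div_sq, smul_eq_mul] at h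
  have e : ∀ v : ℝ, (1 - Real.cos (b * v)) / v ^ 2
      = b ^ 2 * ((1 - Real.cos (b * v)) / (b * v) ^ 2) := by
    intro v
    rw [mul_pow]
    field_simp
  simp_rw [e]
  rw [integral_const_mul, h, abs_of_pos hb]
  field_simp

theorem integral_one_sub_cos_mul_one_sub_cos {b : ℝ} (hb : 0 ≤ b) :
    ∫ v : ℝ in Ioi 0, (1 - Real.cos v) / v ^ 2 * (1 - Real.cos (b * v))
      = Real.pi / 2 * min 1 b := by
  have h1 := integrableOn_one_sub_cos_mul_div_sq 1
  have h2 := integrableOn_one_sub_cos_mul_div_sq b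
  have h3 := (integrableOn_one_sub_cos_mul_div_sq (1 + b)).const_mul (1 / 2)
  have h4 := (integrableOn_one_sub_cos_mul_div_sq (1 - b)).const_mul (1 / 2)
  have e : ∀ v : ℝ, (1 - Real.cos v) / v ^ 2 * (1 - Real.cos (b * v))
      = ((1 - Real.cos (1 * v)) / v ^ 2 + (1 - Real.cos (b * v)) / v ^ 2
        - 1 / 2 * ((1 - Real.cos ((1 + b) * v)) / v ^ 2))
        - 1 / 2 * ((1 - Real.cos ((1 - b) * v)) / v ^ 2) := by
    intro v
    rw [add_mul, sub_mul, Real.cos_add, Real.cos_sub, one_mul]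
    ring
  simp_rw [e]
  rw [integral_sub (by exact (h1.add h2).sub h3) h4, integral_sub (by exact h1.add h2) h3,
    integral_add h1 h2, integral_const_mul, integral_const_mul]
  simp only [integral_one_sub_cos_mul_div_sq]
  rw [abs_of_nonneg hb, abs_one, abs_of_nonneg (by linarith : 0 ≤ 1 + b), min_def]
  split_ifs with h
  · rw [abs_of_nonpos (by linarith)]; ring
  · rw [abs_of_nonneg (by linarith)]; ring

/-- Scaling limit of `∫ K(v) f(v / R) dv` when `f(t) ~ L t ^ ν` at `0+`. -/
theorem tendsto_rpow_mul_integral_comp_div {f K : ℝ → ℝ} {ν L C : ℝ} (hν : 0 < ν)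
    (hf : Measurable f) (hfC : ∀ t, |f t| ≤ C)
    (hlim : Tendsto (fun t => f t / t ^ ν) (𝓝[>] 0) (𝓝 L))
    (hK : Measurable K) (hKν : IntegrableOn (fun v => K v * v ^ ν) (Ioi 0)) :
    Tendsto (fun R : ℝ => R ^ ν * ∫ v in Ioi 0, K v * f (v / R)) atTop
      (𝓝 (L * ∫ v in Ioi 0, K v * v ^ ν)) := by
  obtain ⟨D, hD⟩ : ∃ D, ∀ t, 0 < t → |f t / t ^ ν| ≤ D := by
    have h1 : ∀ᶠ t in 𝓝[>] (0 : ℝ), |f t / t ^ ν| < |L| + 1 :=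
      hlim.abs.eventually_lt_const (by linarith)
    obtain ⟨δ, hδ, h⟩ := mem_nhdsGT_iff_exists_Ioo_subset.1 h1
    have hδ' : (0 : ℝ) < δ := hδ
    refine ⟨max (|L| + 1) (C / δ ^ ν), fun t ht => ?_⟩
    rcases lt_or_ge t δ with h' | h'
    · exact (le_of_lt (h ⟨ht, h'⟩)).trans (le_max_left _ _)
    · refine le_trans ?_ (le_max_right _ _)
      rw [abs_div, abs_of_pos (Real.rpow_pos_of_pos ht ν)]
      have hC : 0 ≤ C := (abs_nonneg _).trans (hfC t)
      have := hfC t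
      gcongr
  have hmain : Tendsto
      (fun R : ℝ => ∫ v in Ioi 0, K v * v ^ ν * (f (v / R) / (v / R) ^ ν)) atTop
      (𝓝 (∫ v in Ioi 0, K v * v ^ ν * L)) := by
    refine tendsto_integral_filter_of_dominated_convergence
      (fun v => |K v * v ^ ν| * D) ?_ ?_ (hKν.abs.mul_const D) ?_
    · exact Eventually.of_forall fun R => Measurable.aestronglyMeasurable (by fun_prop)
    · filter_upwards [eventually_gt_atTop 0] with R hR
      filter_upwards [ae_restrict_mem measurableSet_Ioi] with v hv
      rw [Real.norm_eq_abs, abs_mul]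
      exact mul_le_mul_of_nonneg_left (hD _ (div_pos hv hR)) (abs_nonneg _)
    · filter_upwards [ae_restrict_mem measurableSet_Ioi] with v hv
      refine Tendsto.const_mul _ (hlim.comp ?_)
      refine tendsto_nhdsWithin_iff.2 ⟨tendsto_const_nhds.div_atTop tendsto_id, ?_⟩
      filter_upwards [eventually_gt_atTop 0] with R hR
      exact div_pos hv hR
  rw [integral_mul_const, mul_comm] at hmain
  refine hmain.congr' ?_
  filter_upwards [eventually_gt_atTop 0] with R hR
  rw [← integral_const_mul]
  refine setIntegral_congr_fun measurableSet_Ioi fun v hv => ?_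
  have hv' : (0 : ℝ) < v := hv
  have h1 := (Real.rpow_pos_of_pos hv' ν).ne'
  have h2 := (Real.rpow_pos_of_pos hR ν).ne'
  rw [Real.div_rpow hv'.le hR.le]
  field_simp

section RandomVariable

variable {Ω : Type*} [MeasurableSpace Ω] {P : Measure Ω} [IsProbabilityMeasure P]
  {Y : Ω → ℝ} {ν : ℝ}

theorem integral_mul_integral_comp_swap {g K : ℝ → ℝ} {C : ℝ} (hY : Measurable Y)
    (hg : Measurable g) (hgC : ∀ x, |g x| ≤ C) (hK : Measurable K)
    (hKi : IntegrableOn K (Ioi 0)) :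
    ∫ v in Ioi 0, K v * ∫ ω, g (v * Y ω) ∂P = ∫ ω, (∫ v in Ioi 0, K v * g (v * Y ω)) ∂P := by
  simp_rw [← integral_const_mul]
  refine integral_integral_swap ?_
  have h := (hKi.abs.mul_prod (integrable_const (μ := P) C))
  refine h.mono' (Measurable.aestronglyMeasurable (by unfold Function.uncurry; fun_prop))
    (ae_of_all _ fun p => ?_)
  simp only [Function.uncurry, Real.norm_eq_abs, abs_mul]
  exact mul_le_mul_of_nonneg_left (hgC _) (abs_nonneg _)

/-- If `𝔼[g(tY)] ~ L t ^ ν` at `0+`, then `𝔼[k(Y / R)] ~ L R ^ (-ν) ∫ K(v) v ^ ν dv` at infinity,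
where `k(x) = ∫ K(v) g(x v) dv`. -/
theorem tendsto_rpow_mul_integral_kernel {g K : ℝ → ℝ} {C L : ℝ} (hν : 0 < ν) (hY : Measurable Y)
    (hg : Measurable g) (hgC : ∀ x, |g x| ≤ C)
    (hlim : Tendsto (fun t => (∫ ω, g (t * Y ω) ∂P) / t ^ ν) (𝓝[>] 0) (𝓝 L))
    (hK : Measurable K) (hKi : IntegrableOn K (Ioi 0))
    (hKν : IntegrableOn (fun v => K v * v ^ ν) (Ioi 0)) :
    Tendsto (fun R : ℝ => R ^ ν * ∫ ω, (∫ v in Ioi 0, K v * g (Y ω / R * v)) ∂P) atTop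
      (𝓝 (L * ∫ v in Ioi 0, K v * v ^ ν)) := by
  have hm : Measurable fun t : ℝ => ∫ ω, g (t * Y ω) ∂P := by
    refine (StronglyMeasurable.integral_prod_right (f := fun t ω => g (t * Y ω)) ?_).measurable
    exact Measurable.stronglyMeasurable (by unfold Function.uncurry; fun_prop)
  have hb : ∀ t : ℝ, |∫ ω, g (t * Y ω) ∂P| ≤ C := by
    intro t
    have := norm_integral_le_of_norm_le_const (μ := P) (f := fun ω => g (t * Y ω)) (C := C)
      (ae_of_all _ fun ω => hgC _)
    simpa using this
  refine (tendsto_rpow_mul_integral_comp_div hν hm hb hlim hK hKν).congr fun R => ?_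
  have e : ∀ v ω, v / R * Y ω = v * (Y ω / R) := fun v ω => by ring
  have := integral_mul_integral_comp_swap (P := P) (Y := fun ω => Y ω / R) (hY.div_const R)
    hg hgC hK hKi
  simp_rw [e, this, fun v ω => mul_comm (Y ω / R) v]

theorem tendsto_rpow_mul_integral_min {B : ℝ} (hν0 : 0 < ν) (hν1 : ν < 1) (hY : Measurable Y)
    (hY0 : ∀ ω, 0 ≤ Y ω)
    (hlim : Tendsto (fun t => (∫ ω, (1 - Real.cos (t * Y ω)) ∂P) / t ^ ν) (𝓝[>] 0) (𝓝 B)) :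
    Tendsto (fun R : ℝ => R ^ ν * ∫ ω, min 1 (Y ω / R) ∂P) atTop
      (𝓝 (B / (Real.Gamma (2 - ν) * Real.cos (Real.pi * ν / 2)))) := by
  have e : ∀ v ∈ Ioi (0 : ℝ),
      (1 - Real.cos v) / v ^ 2 * v ^ ν = (1 - Real.cos v) * v ^ (ν - 2) := by
    intro v hv
    rw [Real.rpow_sub hv, Real.rpow_two]
    ring
  have h := tendsto_rpow_mul_integral_kernel (g := fun x => 1 - Real.cos x) (C := 2)
    (K := fun v => (1 - Real.cos v) / v ^ 2) hν0 hY (by fun_prop)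
    (fun x => abs_le.2 ⟨by linarith [Real.cos_le_one x], by linarith [Real.neg_one_le_cos x]⟩)
    hlim (by fun_prop) integrableOn_one_sub_cos_div_sq
    ((integrableOn_one_sub_cos_mul_rpow hν0.le hν1).congr_fun (fun v hv => (e v hv).symm)
      measurableSet_Ioi)
  rw [setIntegral_congr_fun measurableSet_Ioi e,
    integral_one_sub_cos_mul_rpow hν0.le hν1] at h
  have hG : 0 < Real.Gamma (2 - ν) := Real.Gamma_pos_of_pos (by linarith)
  have hcos := cos_pi_mul_div_two_pos hν0.le hν1
  have hpi := Real.pi_pos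
  have h2 := h.const_mul (2 / Real.pi)
  rw [show 2 / Real.pi * (B * (Real.pi / (2 * Real.Gamma (2 - ν) * Real.cos (Real.pi * ν / 2))))
    = B / (Real.Gamma (2 - ν) * Real.cos (Real.pi * ν / 2)) by field_simp] at h2
  refine h2.congr' ?_
  filter_upwards [eventually_gt_atTop 0] with R hR
  simp_rw [fun ω => integral_one_sub_cos_mul_one_sub_cos (div_nonneg (hY0 ω) hR.le)]
  rw [integral_const_mul]
  field_simp

/-- Monotone density theorem for the truncated mean of a non-negative random variable. -/
theorem tendsto_rpow_mul_tail {κ : ℝ} (hY : Measurable Y) (hY0 : ∀ ω, 0 ≤ Y ω)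
    (hlim : Tendsto (fun R : ℝ => R ^ ν * ∫ ω, min 1 (Y ω / R) ∂P) atTop (𝓝 κ)) :
    Tendsto (fun R : ℝ => R ^ ν * P.real {ω | R < Y ω}) atTop (𝓝 ((1 - ν) * κ)) := by
  set m : ℝ → ℝ := fun R => ∫ ω, min 1 (Y ω / R) ∂P with hm
  have hset : ∀ x : ℝ, MeasurableSet {ω | x < Y ω} := fun x =>
    measurableSet_lt measurable_const hY
  have hminR : ∀ R : ℝ, 0 < R → R * m R = ∫ ω, min R (Y ω) ∂P := by
    intro R hR
    rw [hm, ← integral_const_mul]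
    congr 1 with ω
    rw [mul_min_of_nonneg _ _ hR.le, mul_one, mul_div_cancel₀ _ hR.ne']
  have hint : ∀ R : ℝ, 0 < R → Integrable (fun ω => min R (Y ω)) P := by
    intro R hR
    refine Integrable.of_bound (C := R) (Measurable.aestronglyMeasurable (by fun_prop))
      (ae_of_all _ fun ω => ?_)
    rw [Real.norm_of_nonneg (le_min hR.le (hY0 ω))]
    exact min_le_left _ _
  have hind : ∀ d x : ℝ, ∫ ω, {ω | x < Y ω}.indicator (fun _ => d) ω ∂P
      = d * P.real {ω | x < Y ω} := by
    intro d x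
    rw [integral_indicator_const _ (hset x), smul_eq_mul, mul_comm]
  have hindi : ∀ d x : ℝ, Integrable ({ω | x < Y ω}.indicator (fun _ => d)) P := fun d x =>
    (integrable_const d).indicator (hset x)
  have hle : ∀ x y : ℝ, 0 < x → x < y →
      (y - x) * P.real {ω | y < Y ω} ≤ y * m y - x * m x ∧
      y * m y - x * m x ≤ (y - x) * P.real {ω | x < Y ω} := by
    intro x y hx hxy
    rw [hminR x hx, hminR y (hx.trans hxy), ← integral_sub (hint y (hx.trans hxy)) (hint x hx),
      ← hind, ← hind]
    constructor
    · refine integral_mono (hindi _ _) ((hint y (hx.trans hxy)).sub (hint x hx)) fun ω => ?_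
      simp only [indicator_apply, mem_ofPred_eq]
      split_ifs with h
      · rw [min_eq_left h.le, min_eq_left (hxy.trans h).le]
      · linarith [min_le_min_right (Y ω) hxy.le]
    · refine integral_mono ((hint y (hx.trans hxy)).sub (hint x hx)) (hindi _ _) fun ω => ?_
      simp only [indicator_apply, mem_ofPred_eq]
      split_ifs with h
      · rw [min_eq_left h.le]
        linarith [min_le_left y (Y ω)]
      · rw [min_eq_right (not_lt.1 h)]
        linarith [min_le_right y (Y ω)]
  have hq : Tendsto (fun l : ℝ => (l ^ (1 - ν) * κ - κ) / (l - 1)) (𝓝[≠] 1)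
      (𝓝 ((1 - ν) * κ)) := by
    have hd : HasDerivAt (fun l : ℝ => l ^ (1 - ν) * κ) ((1 - ν) * κ) 1 := by
      have := (Real.hasDerivAt_rpow_const (x := 1) (p := 1 - ν) (Or.inl one_ne_zero)).mul_const κ
      simpa using this
    refine hd.tendsto_slope.congr fun l => ?_
    rw [slope_def_field]
    simp
  have hscale : ∀ l : ℝ, 0 < l → Tendsto
      (fun R : ℝ => R ^ ν * ((l * R * m (l * R) - R * m R) / (l * R - R))) atTop
      (𝓝 ((l ^ (1 - ν) * κ - κ) / (l - 1))) := by
    intro l hl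
    have h1 := (hlim.comp (tendsto_id.const_mul_atTop hl)).const_mul (l ^ (1 - ν))
    refine ((h1.sub hlim).div_const (l - 1)).congr' ?_
    filter_upwards [eventually_gt_atTop 0] with R hR
    simp only [Function.comp, id]
    change (l ^ (1 - ν) * ((l * R) ^ ν * m (l * R)) - R ^ ν * m R) / (l - 1) = _
    rw [Real.mul_rpow hl.le hR.le, Real.rpow_sub hl, Real.rpow_one]
    have h3 := (Real.rpow_pos_of_pos hl ν).ne'
    rw [show l * R * m (l * R) - R * m R = R * (l * m (l * R) - m R) by ring,
      show l * R - R = R * (l - 1) by ring, mul_div_mul_left _ _ hR.ne']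
    field_simp
  refine tendsto_order.2 ⟨fun b hb => ?_, fun b hb => ?_⟩
  · obtain ⟨l, hl, hl1⟩ := (((hq.mono_left
      (nhdsWithin_mono 1 (s := Ioi 1) fun x hx => ne_of_gt hx)).eventually_const_lt hb).and
      (self_mem_nhdsWithin (s := Ioi (1 : ℝ)))).exists
    have hl1 : 1 < l := hl1
    filter_upwards [(hscale l (by linarith)).eventually_const_lt hl, eventually_gt_atTop 0]
      with R hR hR0
    refine hR.trans_le ?_
    have hlt : R < l * R := by nlinarith
    gcongr
    rw [div_le_iff₀' (by linarith)]
    exact (hle R (l * R) hR0 hlt).2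
  · obtain ⟨l, hl, hl1⟩ := (((hq.mono_left
      (nhdsWithin_mono 1 (s := Iio 1) fun x hx => ne_of_lt hx)).eventually_lt_const hb).and
      (Ioo_mem_nhdsLT (zero_lt_one' ℝ))).exists
    filter_upwards [(hscale l hl1.1).eventually_lt_const hl, eventually_gt_atTop 0]
      with R hR hR0
    refine lt_of_le_of_lt ?_ hR
    have hlt : l * R < R := by nlinarith [hl1.2]
    gcongr
    rw [← neg_div_neg_eq, neg_sub, neg_sub, le_div_iff₀' (by linarith)]
    exact (hle (l * R) R (mul_pos hl1.1 hR0) hlt).1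

/-- Positivity of the sine transform coefficient of a regularly varying tail. -/
theorem sin_coeff_pos_of_tail {a S : ℝ} (hν0 : 0 < ν) (hY : Measurable Y) (hY0 : ∀ ω, 0 ≤ Y ω)
    (ha : 0 < a)
    (htail : Tendsto (fun R : ℝ => R ^ ν * P.real {ω | R < Y ω}) atTop (𝓝 a))
    (hlim : Tendsto (fun t => (∫ ω, Real.sin (t * Y ω) ∂P) / t ^ ν) (𝓝[>] 0) (𝓝 S)) :
    0 < S := by
  have e : ∀ v : ℝ, Real.exp (-v) * v ^ ν = Real.exp (-v) * v ^ (ν + 1 - 1) := by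
    intro v; rw [add_sub_cancel_right]
  have hexp : IntegrableOn (fun v : ℝ => Real.exp (-v)) (Ioi 0) := by
    simpa using integrableOn_exp_neg_mul_cos one_pos 0
  have hk : ∀ x : ℝ, ∫ v : ℝ in Ioi 0, Real.exp (-v) * Real.sin (x * v) = x / (1 + x ^ 2) := by
    intro x
    simpa using integral_exp_neg_mul_sin one_pos x
  have h := tendsto_rpow_mul_integral_kernel (g := Real.sin) (C := 1)
    (K := fun v => Real.exp (-v)) hν0 hY (by fun_prop) Real.abs_sin_le_one
    hlim (by fun_prop) hexp
    (by simp_rw [e]; exact Real.GammaIntegral_convergent (by linarith))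
  simp_rw [e, hk] at h
  rw [← Real.Gamma_eq_integral (by linarith)] at h
  have hG : 0 < Real.Gamma (ν + 1) := Real.Gamma_pos_of_pos (by linarith)
  have hlow : Tendsto (fun R : ℝ => 2 / 5 * (R ^ ν * P.real {ω | R < Y ω}
      - 2 ^ (-ν) * ((2 * R) ^ ν * P.real {ω | 2 * R < Y ω}))) atTop
      (𝓝 (2 / 5 * (a - 2 ^ (-ν) * a))) :=
    (htail.sub ((htail.comp (tendsto_id.const_mul_atTop two_pos)).const_mul _)).const_mul _
  have hset : ∀ x : ℝ, MeasurableSet {ω | x < Y ω} := fun x =>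
    measurableSet_lt measurable_const hY
  have hindi : ∀ x : ℝ, Integrable ({ω | x < Y ω}.indicator (fun _ => (2 / 5 : ℝ))) P := fun x =>
    (integrable_const _).indicator (hset x)
  have hcmp : 2 / 5 * (a - 2 ^ (-ν) * a) ≤ S * Real.Gamma (ν + 1) := by
    refine le_of_tendsto_of_tendsto hlow h ?_
    filter_upwards [eventually_gt_atTop 0] with R hR
    have h2 : (2 : ℝ) ^ (-ν) * (2 * R) ^ ν = R ^ ν := by
      rw [Real.mul_rpow zero_le_two hR.le, ← mul_assoc, ← Real.rpow_add two_pos]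
      simp
    rw [← mul_assoc, h2, ← mul_sub, mul_left_comm]
    gcongr
    have hi : 2 / 5 * (P.real {ω | R < Y ω} - P.real {ω | 2 * R < Y ω})
        = ∫ ω, ({ω | R < Y ω}.indicator (fun _ => (2 / 5 : ℝ)) ω
          - {ω | 2 * R < Y ω}.indicator (fun _ => (2 / 5 : ℝ)) ω) ∂P := by
      rw [integral_sub (hindi _) (hindi _), integral_indicator_const _ (hset _),
        integral_indicator_const _ (hset _)]
      simp only [smul_eq_mul]
      ring
    rw [hi]
    refine integral_mono ((hindi _).sub (hindi _)) ?_ fun ω => ?_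
    · refine Integrable.of_bound (C := 1) (Measurable.aestronglyMeasurable (by fun_prop))
        (ae_of_all _ fun ω => ?_)
      have h0 : 0 ≤ Y ω / R := div_nonneg (hY0 ω) hR.le
      rw [Real.norm_of_nonneg (by positivity), div_le_one (by positivity)]
      nlinarith [sq_nonneg (Y ω / R - 1)]
    · have h0 : 0 ≤ Y ω / R := div_nonneg (hY0 ω) hR.le
      have hpos : 0 ≤ Y ω / R / (1 + (Y ω / R) ^ 2) := by positivity
      simp only [indicator_apply, mem_ofPred_eq]
      split_ifs with h1 h2 h2
      · simpa using hpos
      · have h3 : 1 ≤ Y ω / R := (one_le_div hR).2 h1.le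
        have h4 : Y ω / R ≤ 2 := (div_le_iff₀ hR).2 (not_lt.1 h2)
        rw [sub_zero, div_le_div_iff₀ (by norm_num) (by positivity)]
        nlinarith
      · linarith
      · simpa using hpos
  have h2 : (2 : ℝ) ^ (-ν) < 1 := Real.rpow_lt_one_of_one_lt_of_neg one_lt_two (by linarith)
  have : 0 < S * Real.Gamma (ν + 1) := by
    refine lt_of_lt_of_le ?_ hcmp
    nlinarith
  exact pos_of_mul_pos_left this hG.le

end RandomVariable

end AuxiliaryLemmas

/-- **Tauberian theorem, order `ν ∈ (0,1)`.**  Let `X` be a non-negative integer-valued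
random variable with characteristic function `φ(t) = 𝔼[e^{itX}]`.  If
`φ(t) = 1 + (c 1_{t>0} + c̄ 1_{t<0}) |t|^ν + o(|t|^ν)` as `t → 0` for some `c` with
`Re c ≠ 0` and `ν ∈ (0,1)`, then necessarily `Re c < 0` and `Im c > 0`, and with
`a = -(Re c / Γ(1-ν)) sec(πν/2) > 0` one has `ℙ[X > R] = a R^{-ν} + o(R^{-ν})`
as `R → ∞`. -/
theorem stmt_14
    {Ω : Type*} [MeasurableSpace Ω] (P : Measure Ω) [IsProbabilityMeasure P]
    (X : Ω → ℕ) (hX : Measurable X)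
    (φ : ℝ → ℂ)
    (hφ : ∀ t : ℝ, φ t = ∫ ω, Complex.exp (Complex.I * (t : ℂ) * (X ω : ℂ)) ∂P)
    (c : ℂ) (hc : c.re ≠ 0)
    (ν : ℝ) (hν0 : 0 < ν) (hν1 : ν < 1)
    (hasymp : (fun t : ℝ => φ t -
        (1 + (if 0 < t then c else starRingEnd ℂ c) * ((|t| ^ ν : ℝ) : ℂ)))
        =o[𝓝[≠] (0 : ℝ)] fun t : ℝ => |t| ^ ν)
    (a : ℝ) (ha : a = -(c.re / Real.Gamma (1 - ν)) * (Real.cos (Real.pi * ν / 2))⁻¹) :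
    c.re < 0 ∧ 0 < c.im ∧ 0 < a ∧
      (fun R : ℝ => (P {ω | R < (X ω : ℝ)}).toReal - a * R ^ (-ν))
        =o[atTop] fun R : ℝ => R ^ (-ν) := by
  have hY : Measurable fun ω => (X ω : ℝ) := by fun_prop
  have hint : ∀ t : ℝ, Integrable (fun ω => Complex.exp (Complex.I * (t : ℂ) * (X ω : ℂ))) P := by
    intro t
    refine Integrable.of_bound (C := 1) (Measurable.aestronglyMeasurable (by fun_prop))
      (ae_of_all _ fun ω => ?_)
    rw [show Complex.I * (t : ℂ) * (X ω : ℂ) = ((t * X ω : ℝ) : ℂ) * I by push_cast; ring,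
      Complex.norm_exp_ofReal_mul_I]
  have hexp : ∀ (t : ℝ) (ω : Ω), Complex.exp (Complex.I * (t : ℂ) * (X ω : ℂ))
      = ((Real.cos (t * X ω) : ℝ) : ℂ) + ((Real.sin (t * X ω) : ℝ) : ℂ) * I := by
    intro t ω
    rw [show Complex.I * (t : ℂ) * (X ω : ℂ) = ((t * X ω : ℝ) : ℂ) * I by push_cast; ring,
      Complex.exp_mul_I]
    push_cast
    ring
  have hre : ∀ t : ℝ, ∫ ω, (1 - Real.cos (t * X ω)) ∂P = 1 - (φ t).re := by
    intro t
    have h1 : ∫ ω, Real.cos (t * X ω) ∂P = (φ t).re := by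
      rw [hφ t]
      simpa [hexp, -ofReal_cos, -ofReal_sin] using integral_re (hint t)
    have h2 : Integrable (fun ω => Real.cos (t * X ω)) P := by
      simpa [hexp, -ofReal_cos, -ofReal_sin] using (hint t).re
    rw [integral_sub (integrable_const _) h2, h1]
    simp
  have him : ∀ t : ℝ, ∫ ω, Real.sin (t * X ω) ∂P = (φ t).im := by
    intro t
    rw [hφ t]
    simpa [hexp, -ofReal_cos, -ofReal_sin] using integral_im (hint t)
  have hlim : Tendsto (fun t : ℝ => (φ t - 1) / ((t ^ ν : ℝ) : ℂ)) (𝓝[>] 0) (𝓝 c) := by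
    have h1 := hasymp.mono (nhdsWithin_mono 0 (s := Set.Ioi 0) fun x hx => ne_of_gt hx)
    have h2 : (fun t : ℝ => φ t - 1 - c * ((t ^ ν : ℝ) : ℂ)) =o[𝓝[>] (0 : ℝ)]
        fun t : ℝ => ((t ^ ν : ℝ) : ℂ) := by
      refine (h1.congr' ?_ ?_).trans_le fun t => (Complex.norm_real _).ge
      · filter_upwards [self_mem_nhdsWithin] with t ht
        have ht : 0 < t := ht
        rw [if_pos ht, abs_of_pos ht]
        ring
      · filter_upwards [self_mem_nhdsWithin] with t ht
        have ht : 0 < t := ht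
        rw [abs_of_pos ht]
    have h3 := h2.tendsto_div_nhds_zero.add_const c
    rw [zero_add] at h3
    refine h3.congr' ?_
    filter_upwards [self_mem_nhdsWithin] with t ht
    have ht : ((t ^ ν : ℝ) : ℂ) ≠ 0 := by exact_mod_cast (Real.rpow_pos_of_pos ht ν).ne'
    field_simp
    ring
  have hcos : Tendsto (fun t : ℝ => (∫ ω, (1 - Real.cos (t * X ω)) ∂P) / t ^ ν) (𝓝[>] 0)
      (𝓝 (-c.re)) := by
    refine ((continuous_re.tendsto c).comp hlim).neg.congr fun t => ?_
    simp only [Function.comp, div_ofReal_re, sub_re, one_re, hre]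
    ring
  have hsin : Tendsto (fun t : ℝ => (∫ ω, Real.sin (t * X ω) ∂P) / t ^ ν) (𝓝[>] 0)
      (𝓝 c.im) := by
    refine ((continuous_im.tendsto c).comp hlim).congr fun t => ?_
    simp only [Function.comp, div_ofReal_im, sub_im, one_im, him, sub_zero]
  have hcre : c.re < 0 := by
    have : 0 ≤ -c.re := by
      refine ge_of_tendsto hcos ?_
      filter_upwards [self_mem_nhdsWithin] with t ht
      have ht : 0 < t := ht
      exact div_nonneg (integral_nonneg fun ω => by simpa using Real.cos_le_one _) (by positivity)
    exact lt_of_le_of_ne (by linarith) hc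
  have hG : 0 < Real.Gamma (1 - ν) := Real.Gamma_pos_of_pos (by linarith)
  have hcpos := cos_pi_mul_div_two_pos hν0.le hν1
  have ha0 : 0 < a := by
    rw [ha, ← neg_div]
    have : 0 < -c.re := by linarith
    positivity
  have hnn : ∀ ω, (0 : ℝ) ≤ X ω := fun ω => Nat.cast_nonneg _
  have htail := tendsto_rpow_mul_tail hY hnn (tendsto_rpow_mul_integral_min hν0 hν1 hY hnn hcos)
  have haeq : (1 - ν) * (-c.re / (Real.Gamma (2 - ν) * Real.cos (Real.pi * ν / 2))) = a := by
    have h1 : (1 - ν) ≠ 0 := by linarith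
    rw [ha, show 2 - ν = (1 - ν) + 1 by ring, Real.Gamma_add_one h1]
    field_simp
  rw [haeq] at htail
  refine ⟨hcre, sin_coeff_pos_of_tail hν0 hY hnn ha0 htail hsin, ha0, ?_⟩
  refine (isLittleO_iff_tendsto' ?_).2 ?_
  · filter_upwards [eventually_gt_atTop 0] with R hR h
    exact absurd h (Real.rpow_pos_of_pos hR _).ne'
  · have h := htail.sub_const a
    rw [sub_self] at h
    refine h.congr' ?_
    filter_upwards [eventually_gt_atTop 0] with R hR
    have h1 := (Real.rpow_pos_of_pos hR ν).ne'
    rw [Real.rpow_neg hR.le, Measure.real]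
    field_simp
end
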